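/- arXiv:1612.03559 — 4 statements merged into one kernel-verified Lean document; each statement's English description precedes it below -/
import Mathlib

section
/- Let X be a second-countable, locally compact Hausdorff space of covering dimension at most d, and let V → X be a locally trivial complex vector bundle of rank n equipped with a Hermitian metric. Then there exist (d+1)·n continuous sections F₁, …, F_{(d+1)n} of V, each bounded in the sense that sup_{x∈X} ‖F_k(x)‖_x < ∞, such that for every x ∈ X and every v in the fiber V_x one has v = ∑_{k=1}^{(d+1)n} ⟨F_k(x), v⟩_x · F_k(x). -/
open Filter Topology

/-- A locally trivial, finite-rank complex vector bundle over `X`: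
fibres `E x`, a topology on the total space `Σ x, E x`, and local
trivialisations with fibre `ℂ^n` (the rank `n` may vary between components). -/
structure CplxVectorBundle (X : Type) [TopologicalSpace X] where
  E : X → Type
  [addCommGroup : ∀ x, AddCommGroup (E x)]
  [module : ∀ x, Module ℂ (E x)]
  [topTotal : TopologicalSpace (Σ x, E x)]
  locTriv : ∀ x₀ : X, ∃ (n : ℕ) (U : Set X), IsOpen U ∧ x₀ ∈ U ∧
    ∃ φ : ∀ x, x ∈ U → (E x ≃ₗ[ℂ] (Fin n → ℂ)),
      IsHomeomorph (fun p : {q : Σ x, E x // q.1 ∈ U} =>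
        ((⟨p.1.1, p.2⟩, φ p.1.1 p.2 p.1.2) : U × (Fin n → ℂ)))

attribute [instance] CplxVectorBundle.addCommGroup CplxVectorBundle.module
  CplxVectorBundle.topTotal

/-- A section is continuous if it is continuous as a map into the total space. -/
def CplxVectorBundle.IsContinuousSection {X : Type} [TopologicalSpace X]
    (V : CplxVectorBundle X) (s : ∀ x, V.E x) : Prop :=
  Continuous fun x => (⟨x, s x⟩ : Σ x, V.E x)

/-- The bundle has rank `n` if every fibre is `n`-dimensional. -/
def CplxVectorBundle.HasRank {X : Type} [TopologicalSpace X]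
    (V : CplxVectorBundle X) (n : ℕ) : Prop :=
  ∀ x, Module.finrank ℂ (V.E x) = n

/-- `V` is isomorphic to the pullback of `W` along `ι` : there are fibrewise linear
isomorphisms for which the canonical fibrewise-linear bijection from the total space of
`V` to the pullback realises the topology of `V` as the pullback topology (induced from
`X × (total space of W)`). -/
def IsPullbackOf {X Y : Type} [TopologicalSpace X] [TopologicalSpace Y]
    (V : CplxVectorBundle X) (W : CplxVectorBundle Y) (ι : X → Y) : Prop :=
  ∃ φ : ∀ x, V.E x ≃ₗ[ℂ] W.E (ι x),
    Topology.IsInducing (fun p : Σ x, V.E x =>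
      ((p.1, ⟨ι p.1, φ p.1 p.2⟩) : X × Σ y, W.E y))

/-- A Hermitian metric: a continuous family of inner products on the fibres
(conjugate-linear in the first variable). -/
structure HermitianMetric {X : Type} [TopologicalSpace X] (V : CplxVectorBundle X) where
  inner : ∀ x, V.E x → V.E x → ℂ
  conj_symm : ∀ x u v, (starRingEnd ℂ) (inner x u v) = inner x v u
  add_right : ∀ x u v w, inner x u (v + w) = inner x u v + inner x u w
  smul_right : ∀ x (c : ℂ) u v, inner x u (c • v) = c * inner x u v
  nonneg : ∀ x v, 0 ≤ (inner x v v).re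
  definite : ∀ x v, inner x v v = 0 → v = 0
  continuous_inner : Continuous fun q : {p : (Σ x, V.E x) × (Σ x, V.E x) // p.1.1 = p.2.1} =>
    inner q.1.1.1 q.1.1.2 (cast (congrArg V.E q.2).symm q.1.2.2)

/-- The fibre norm associated to a Hermitian metric. -/
noncomputable def HermitianMetric.fibNorm {X : Type} [TopologicalSpace X]
    {V : CplxVectorBundle X} (h : HermitianMetric V) (x : X) (v : V.E x) : ℝ :=
  Real.sqrt ((h.inner x v v).re)

/-- `X` has covering dimension at most `d`: every open cover has an open refinement
in which every point lies in at most `d + 1` members. -/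
def CoveringDimLE (X : Type) [TopologicalSpace X] (d : ℕ) : Prop :=
  ∀ 𝒰 : Set (Set X), (∀ U ∈ 𝒰, IsOpen U) → ⋃₀ 𝒰 = Set.univ →
    ∃ 𝒱 : Set (Set X), (∀ W ∈ 𝒱, IsOpen W) ∧ ⋃₀ 𝒱 = Set.univ ∧
      (∀ W ∈ 𝒱, ∃ U ∈ 𝒰, W ⊆ U) ∧
      ∀ x : X, {W ∈ 𝒱 | x ∈ W}.Finite ∧ {W ∈ 𝒱 | x ∈ W}.ncard ≤ d + 1

/-- A compactification of `X`: a compact Hausdorff space together with a dense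
embedding of `X`. -/
structure Compactification (X : Type) [TopologicalSpace X] where
  space : Type
  [top : TopologicalSpace space]
  [cpt : CompactSpace space]
  [t2 : T2Space space]
  ι : X → space
  emb : Topology.IsEmbedding ι
  dense : DenseRange ι

attribute [instance] Compactification.top Compactification.cpt Compactification.t2

open scoped ComplexOrder MatrixOrder Matrix.Norms.L2Operator in
theorem continuousOn_sqrt_posSemidef (n : ℕ) :
    ContinuousOn (fun M : Matrix (Fin n) (Fin n) ℂ => CFC.sqrt M) {M | M.PosSemidef} := by
  have := ContinuousOn.cfc_nnreal_of_mem_nhdsSet (A := Matrix (Fin n) (Fin n) ℂ)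
    (X := Matrix (Fin n) (Fin n) ℂ) (s := Set.univ) NNReal.sqrt (a := id)
    (t := {M | M.PosSemidef}) Filter.univ_mem continuousOn_id
    (fun x hx => Matrix.PosSemidef.nonneg hx) NNReal.continuous_sqrt.continuousOn
  refine this.congr fun M hM => ?_
  exact CFC.sqrt_eq_cfc

open scoped ComplexOrder MatrixOrder Matrix.Norms.L2Operator in
/-- Positive definite matrices factor as `Bᴴ * B`, with `B` invertible and depending continuously
on the matrix. -/
theorem exists_continuousOn_conjTranspose_mul_self (n : ℕ) :
    ∃ B : Matrix (Fin n) (Fin n) ℂ → Matrix (Fin n) (Fin n) ℂ,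
      ContinuousOn B {M | M.PosDef} ∧
      ∀ M : Matrix (Fin n) (Fin n) ℂ, M.PosDef → (B M).conjTranspose * B M = M ∧ IsUnit (B M) := by
  refine ⟨fun M => CFC.sqrt M,
    (continuousOn_sqrt_posSemidef n).mono fun M hM => Matrix.PosDef.posSemidef hM, fun M hM => ?_⟩
  have h0 : 0 ≤ M := hM.posSemidef.nonneg
  have hmul : CFC.sqrt M * CFC.sqrt M = M := CFC.sqrt_mul_sqrt_self M
  have hherm : (CFC.sqrt M).conjTranspose = CFC.sqrt M :=
    (Matrix.nonneg_iff_posSemidef.1 (CFC.sqrt_nonneg M)).isHermitian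
  refine ⟨by rw [hherm, hmul], ?_⟩
  have := hM.isUnit
  rw [← hmul] at this
  exact (Commute.refl _).isUnit_mul_iff.1 this |>.1

/-- A covering of dimension at most `d`, in terms of functions: the squares of `a 0, …, a d` form a
partition of unity, and each `a i` is nonzero only where a locally constant
choice of a member of the cover is available. -/
theorem CoveringDimLE.exists_functions {X ι : Type} [TopologicalSpace X] [NormalSpace X]
    [ParacompactSpace X] {d : ℕ} (hdim : CoveringDimLE X d) (U : ι → Set X)
    (hU : ∀ i, IsOpen (U i)) (hcov : ⋃ i, U i = Set.univ) [Nonempty ι] :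
    ∃ (a : Fin (d + 1) → X → ℝ) (p : Fin (d + 1) → X → ι),
      (∀ i, Continuous (a i)) ∧ (∀ x, ∑ i, a i x ^ 2 = 1) ∧
      (∀ i x, a i x ≠ 0 → x ∈ U (p i x) ∧ ∀ᶠ y in 𝓝 x, p i y = p i x) := by
  classical
  obtain ⟨𝒱, hVo, hVc, hVU, hVd⟩ := hdim (Set.range U) (by rintro _ ⟨i, rfl⟩; exact hU i)
    (by rw [Set.sUnion_range, hcov])
  have hVU' : ∀ W : 𝒱, ∃ i, (W : Set X) ⊆ U i := by
    intro W
    obtain ⟨_, ⟨i, rfl⟩, h⟩ := hVU W W.2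
    exact ⟨i, h⟩
  choose r hr using hVU'
  obtain ⟨φ, hφ⟩ := PartitionOfUnity.exists_isSubordinate (s := Set.univ) isClosed_univ
    (fun W : 𝒱 => (W : Set X)) (fun W => hVo W W.2) (by rw [← Set.sUnion_eq_iUnion, hVc])
  have hmem : ∀ (W : 𝒱) x, φ W x ≠ 0 → x ∈ (W : Set X) := fun W x hx =>
    hφ W (subset_tsupport _ hx)
  -- the support at a point has at most `d + 1` elements
  have hsupp : ∀ x, ∃ S : Finset 𝒱, S.Nonempty ∧ S.card ≤ d + 1 ∧ ∀ W, W ∈ S ↔ 0 < φ W x := by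
    intro x
    have hinj : Set.InjOn (Subtype.val : 𝒱 → Set X) {W : 𝒱 | 0 < φ W x} :=
      Subtype.val_injective.injOn
    have hmaps : Set.MapsTo (Subtype.val : 𝒱 → Set X) {W : 𝒱 | 0 < φ W x}
        {W ∈ 𝒱 | x ∈ W} := fun W hW => ⟨W.2, hmem W x (ne_of_gt hW)⟩
    have hfin : {W : 𝒱 | 0 < φ W x}.Finite := Set.Finite.of_injOn hmaps hinj (hVd x).1
    refine ⟨hfin.toFinset, ?_, ?_, fun W => by simp⟩
    · obtain ⟨W, hW⟩ := φ.exists_pos (Set.mem_univ x)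
      exact ⟨W, by simpa using hW⟩
    · rw [← Set.ncard_eq_toFinset_card _ hfin]
      exact (Set.ncard_le_ncard_of_injOn _ hmaps hinj (hVd x).1).trans (hVd x).2
  -- the family is equicontinuous
  have hequi : ∀ x (ε : ℝ), 0 < ε → ∀ᶠ y in 𝓝 x, ∀ W, |φ W y - φ W x| ≤ ε := by
    intro x ε hε
    obtain ⟨N, hN, hfin⟩ := φ.locallyFinite x
    have h1 : ∀ᶠ y in 𝓝 x, ∀ W ∈ {W | (Function.support (φ W) ∩ N).Nonempty},
        |φ W y - φ W x| ≤ ε := by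
      rw [Filter.eventually_all_finite hfin]
      intro W _
      have := (φ W).continuous.continuousAt (x := x)
      filter_upwards [Metric.tendsto_nhds.1 this ε hε] with y hy
      exact hy.le
    filter_upwards [h1, hN] with y hy hyN W
    by_cases hW : (Function.support (φ W) ∩ N).Nonempty
    · exact hy W hW
    · have h0 : ∀ z ∈ N, φ W z = 0 := fun z hz => by
        by_contra hne
        exact hW ⟨z, hne, hz⟩
      rw [h0 y hyN, h0 x (mem_of_mem_nhds hN)]
      simpa using hε.le
  let P : Finset 𝒱 → X → ℝ → Prop := fun S x t =>
    ∀ W ∈ S, t ≤ φ W x ∧ ∀ W' ∉ S, φ W' x + t ≤ φ W x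
  have hPmove : ∀ S x y t ε, P S x t → (∀ W, |φ W y - φ W x| ≤ ε) → 0 ≤ ε →
      P S y (t - 2 * ε) := by
    intro S x y t ε hP hε hε0 W hW
    have h1 := abs_le.1 (hε W)
    refine ⟨by linarith [(hP W hW).1], fun W' hW' => ?_⟩
    have h2 := abs_le.1 (hε W')
    linarith [(hP W hW).2 W' hW']
  have hPuniq : ∀ S S' x t t', P S x t → P S' x t' → 0 < t → 0 < t' → S.card = S'.card →
      S = S' := by
    intro S S' x t t' hP hP' ht ht' hc
    by_contra hne
    have h1 : ∃ W ∈ S, W ∉ S' := by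
      by_contra! hcon
      exact hne (Finset.eq_of_subset_of_card_le hcon hc.ge)
    have h2 : ∃ W ∈ S', W ∉ S := by
      by_contra! hcon
      exact hne (Finset.eq_of_subset_of_card_le hcon hc.le).symm
    obtain ⟨W, hW, hW'⟩ := h1
    obtain ⟨Z, hZ, hZ'⟩ := h2
    linarith [(hP W hW).2 Z hZ', (hP' Z hZ).2 W hW']
  let Q : Fin (d + 1) → X → Set ℝ := fun i x =>
    insert 0 {t | ∃ S : Finset 𝒱, S.card = i + 1 ∧ P S x t}
  have hQbdd : ∀ i x, BddAbove (Q i x) := by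
    intro i x
    refine ⟨1, ?_⟩
    rintro t (rfl | ⟨S, hS, hP⟩)
    · exact zero_le_one
    · obtain ⟨W, hW⟩ : S.Nonempty := Finset.card_pos.1 (by omega)
      exact (hP W hW).1.trans (φ.le_one W x)
  let g : Fin (d + 1) → X → ℝ := fun i x => sSup (Q i x)
  have hg0 : ∀ i x, 0 ≤ g i x := fun i x => le_csSup (hQbdd i x) (Set.mem_insert _ _)
  have hgle : ∀ i x y ε, 0 ≤ ε → (∀ W, |φ W y - φ W x| ≤ ε) → g i x ≤ g i y + 2 * ε := by
    intro i x y ε hε0 hε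
    refine csSup_le ⟨0, Set.mem_insert _ _⟩ ?_
    rintro t (rfl | ⟨S, hS, hP⟩)
    · linarith [hg0 i y]
    · have : t - 2 * ε ≤ g i y := le_csSup (hQbdd i y)
        (Or.inr ⟨S, hS, hPmove S x y t ε hP hε hε0⟩)
      linarith
  have hgcont : ∀ i, Continuous (g i) := by
    intro i
    rw [continuous_iff_continuousAt]
    intro x
    refine Metric.tendsto_nhds.2 fun ε hε => ?_
    filter_upwards [hequi x (ε / 4) (by linarith)] with y hy
    have h1 := hgle i x y _ (by linarith) hy
    have h2 := hgle i y x (ε / 4) (by linarith) (fun W => by rw [abs_sub_comm]; exact hy W)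
    rw [Real.dist_eq, abs_lt]
    constructor <;> linarith
  have hgpos : ∀ i x, g i x ≠ 0 → ∃ S : Finset 𝒱, S.card = i + 1 ∧ ∃ t > 0, P S x t := by
    intro i x hne
    have hlt : 0 < g i x := lt_of_le_of_ne (hg0 i x) hne.symm
    obtain ⟨t, ht, ht0⟩ := exists_lt_of_lt_csSup ⟨0, Set.mem_insert _ _⟩ hlt
    rcases ht with rfl | ⟨S, hS, hP⟩
    · exact absurd ht0 (lt_irrefl _)
    · exact ⟨S, hS, t, ht0, hP⟩
  have hgsum : ∀ x, 0 < ∑ i, g i x := by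
    intro x
    obtain ⟨S, hne, hcard, hS⟩ := hsupp x
    have hc := Finset.card_pos.2 hne
    refine Finset.sum_pos' (fun i _ => hg0 i x) ⟨⟨S.card - 1, by omega⟩, Finset.mem_univ _, ?_⟩
    obtain ⟨W₀, hW₀, hmin⟩ := S.exists_min_image (fun W => φ W x) hne
    refine lt_of_lt_of_le ((hS W₀).1 hW₀) (le_csSup (hQbdd _ x) (Or.inr ⟨S, ?_, ?_⟩))
    · simp only; omega
    · intro W hW
      refine ⟨hmin W hW, fun W' hW' => ?_⟩
      have : φ W' x = 0 := le_antisymm (not_lt.1 fun h => hW' ((hS W').2 h)) (φ.nonneg W' x)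
      rw [this, zero_add]
      exact hmin W hW
  let T : Fin (d + 1) → X → Finset 𝒱 := fun i x =>
    if h : ∃ S : Finset 𝒱, S.card = i + 1 ∧ ∃ t > 0, P S x t then h.choose else ∅
  have hT : ∀ (i : Fin (d + 1)) x S t, S.card = (i : ℕ) + 1 → 0 < t → P S x t → T i x = S := by
    intro i x S t hS ht hP
    have h : ∃ S : Finset 𝒱, S.card = (i : ℕ) + 1 ∧ ∃ t > 0, P S x t := ⟨S, hS, t, ht, hP⟩
    obtain ⟨hc, t', ht', hP'⟩ := h.choose_spec
    have hTe : T i x = h.choose := dif_pos h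
    rw [hTe]
    exact hPuniq _ _ x t' t hP' hP ht' ht (hc.trans hS.symm)
  let c : Finset 𝒱 → ι := fun S => if h : S.Nonempty then r h.choose else Classical.arbitrary ι
  refine ⟨fun i x => Real.sqrt (g i x / ∑ j, g j x), fun i x => c (T i x), ?_, ?_, ?_⟩
  · intro i
    exact ((hgcont i).div (continuous_finsetSum _ fun j _ => hgcont j)
      fun x => (hgsum x).ne').sqrt
  · intro x
    have : ∀ i, Real.sqrt (g i x / ∑ j, g j x) ^ 2 = g i x / ∑ j, g j x := fun i =>
      Real.sq_sqrt (div_nonneg (hg0 i x) (hgsum x).le)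
    simp only [this]
    rw [← Finset.sum_div, div_self (hgsum x).ne']
  · intro i x hne
    have hgne : g i x ≠ 0 := by
      intro h0
      exact hne (by simp [h0])
    obtain ⟨S, hS, t, ht, hP⟩ := hgpos i x hgne
    have hSne : S.Nonempty := Finset.card_pos.1 (by omega)
    have hTx := hT i x S t hS ht hP
    constructor
    · simp only [hTx]
      have hc : c S = r hSne.choose := dif_pos hSne
      rw [hc]
      exact hr _ (hmem _ x (ht.trans_le (hP _ hSne.choose_spec).1).ne')
    · filter_upwards [hequi x (t / 4) (by linarith)] with y hy
      rw [hTx, hT i y S _ hS (by linarith) (hPmove S x y t (t / 4) hP hy (by linarith))]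

theorem HermitianMetric.continuousAt_inner {X : Type} [TopologicalSpace X]
    {V : CplxVectorBundle X} (h : HermitianMetric V) {s t : ∀ x, V.E x} {x : X}
    (hs : ContinuousAt (fun x => (⟨x, s x⟩ : Σ x, V.E x)) x)
    (ht : ContinuousAt (fun x => (⟨x, t x⟩ : Σ x, V.E x)) x) :
    ContinuousAt (fun x => h.inner x (s x) (t x)) x := by
  have hst : ContinuousAt (fun x => (⟨(⟨x, s x⟩, ⟨x, t x⟩), rfl⟩ :
      {p : (Σ x, V.E x) × (Σ x, V.E x) // p.1.1 = p.2.1})) x :=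
    Topology.IsInducing.subtypeVal.continuousAt_iff.2 (hs.prodMk ht)
  exact ContinuousAt.comp (f := fun x => (⟨(⟨x, s x⟩, ⟨x, t x⟩), rfl⟩ :
      {p : (Σ x, V.E x) × (Σ x, V.E x) // p.1.1 = p.2.1})) h.continuous_inner.continuousAt hst

/-- Around every point there are fibrewise coordinates detecting continuity of sections. -/
theorem CplxVectorBundle.HasRank.exists_coordinates {X : Type} [TopologicalSpace X]
    {V : CplxVectorBundle X} {n : ℕ} (hV : V.HasRank n) (x₀ : X) :
    ∃ U : Set X, IsOpen U ∧ x₀ ∈ U ∧ ∃ φ : ∀ x, V.E x ≃ₗ[ℂ] (Fin n → ℂ),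
      ∀ (s : ∀ x, V.E x), ∀ x ∈ U,
        (ContinuousAt (fun x => (⟨x, s x⟩ : Σ x, V.E x)) x ↔
          ContinuousAt (fun x => φ x (s x)) x) := by
  classical
  have hrank : ∀ x m, (V.E x ≃ₗ[ℂ] (Fin m → ℂ)) → m = n := fun x m e => by
    rw [← hV x, e.finrank_eq, Module.finrank_fin_fun]
  have hex : ∀ x, Nonempty (V.E x ≃ₗ[ℂ] (Fin n → ℂ)) := by
    intro x
    obtain ⟨m, U, -, hx, φ, -⟩ := V.locTriv x
    obtain rfl := hrank x m (φ x hx)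
    exact ⟨φ x hx⟩
  obtain ⟨m, U, hUo, hx₀, φ, hφ⟩ := V.locTriv x₀
  obtain rfl := hrank x₀ m (φ x₀ hx₀)
  refine ⟨U, hUo, hx₀, fun x => if hx : x ∈ U then φ x hx else (hex x).some, fun s x hx => ?_⟩
  have hemb := hUo.isOpenEmbedding_subtypeVal
  rw [← hemb.continuousAt_iff (f := Subtype.val) (x := ⟨x, hx⟩),
    ← hemb.continuousAt_iff (f := Subtype.val) (x := ⟨x, hx⟩)]
  let σ : U → {q : Σ x, V.E x // q.1 ∈ U} := fun y => ⟨⟨y, s y⟩, y.2⟩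
  have h1 : ContinuousAt ((fun x => (⟨x, s x⟩ : Σ x, V.E x)) ∘ Subtype.val) (⟨x, hx⟩ : U) ↔
      ContinuousAt σ ⟨x, hx⟩ :=
    (Topology.IsInducing.subtypeVal.continuousAt_iff (f := σ)).symm
  rw [h1, hφ.isInducing.continuousAt_iff]
  have h2 : (fun x => (if hx : x ∈ U then φ x hx else (hex x).some) (s x)) ∘ Subtype.val =
      fun y : U => φ y y.2 (s y) := by
    funext y
    simp [y.2]
  rw [h2]
  constructor
  · intro hc
    exact continuous_snd.continuousAt.comp hc
  · intro hc
    exact continuousAt_id.prodMk hc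

open scoped ComplexOrder Matrix in
/-- Around every point there are fibrewise orthonormal coordinates detecting continuity of
sections. -/
theorem HermitianMetric.exists_orthonormal_coordinates {X : Type} [TopologicalSpace X]
    {V : CplxVectorBundle X} {n : ℕ} (hV : V.HasRank n) (h : HermitianMetric V) (x₀ : X) :
    ∃ U : Set X, IsOpen U ∧ x₀ ∈ U ∧ ∃ ψ : ∀ x, V.E x ≃ₗ[ℂ] (Fin n → ℂ),
      (∀ x u v, h.inner x u v = star (ψ x u) ⬝ᵥ ψ x v) ∧
      ∀ (s : ∀ x, V.E x), ∀ x ∈ U,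
        (ContinuousAt (fun x => (⟨x, s x⟩ : Σ x, V.E x)) x ↔
          ContinuousAt (fun x => ψ x (s x)) x) := by
  classical
  obtain ⟨U, hUo, hx₀, φ, hφ⟩ := hV.exists_coordinates x₀
  obtain ⟨B, hBc, hB⟩ := exists_continuousOn_conjTranspose_mul_self n
  let e : Fin n → ∀ x, V.E x := fun i x => (φ x).symm (Pi.single i 1)
  let G : X → Matrix (Fin n) (Fin n) ℂ := fun x => Matrix.of fun i j => h.inner x (e i x) (e j x)
  -- the inner product as a sesquilinear form
  let R : ∀ x, V.E x → V.E x →ₗ[ℂ] ℂ := fun x u =>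
    { toFun := h.inner x u
      map_add' := h.add_right x u
      map_smul' := fun c v => h.smul_right x c u v }
  have hR : ∀ x u v, h.inner x u v = R x u v := fun _ _ _ => rfl
  have hexp : ∀ x v, v = ∑ i, φ x v i • e i x := by
    intro x v
    apply (φ x).injective
    simp only [e, map_sum, map_smul, LinearEquiv.apply_symm_apply]
    exact pi_eq_sum_univ' _
  have hright : ∀ x u v, h.inner x u v = ∑ j, φ x v j * h.inner x u (e j x) := by
    intro x u v
    conv_lhs => rw [hR, hexp x v]
    simp only [map_sum, map_smul, smul_eq_mul, hR]
  have hG : ∀ x u v, h.inner x u v = star (φ x u) ⬝ᵥ (G x *ᵥ φ x v) := by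
    intro x u v
    have hleft : ∀ j, h.inner x u (e j x) = ∑ i, star (φ x u i) * G x i j := by
      intro j
      rw [← h.conj_symm, hright x (e j x) u, map_sum]
      refine Finset.sum_congr rfl fun i _ => ?_
      rw [map_mul, h.conj_symm]
      rfl
    rw [hright, Matrix.dotProduct_mulVec]
    simp only [hleft, dotProduct, Matrix.vecMul, Pi.star_apply]
    exact Finset.sum_congr rfl fun j _ => mul_comm _ _
  have hpd : ∀ x, (G x).PosDef := by
    intro x
    refine Matrix.PosDef.of_dotProduct_mulVec_pos ?_ ?_
    · ext i j
      exact h.conj_symm x (e j x) (e i x)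
    · intro c hc
      have h1 := hG x ((φ x).symm c) ((φ x).symm c)
      rw [LinearEquiv.apply_symm_apply] at h1
      rw [← h1]
      have hne : h.inner x ((φ x).symm c) ((φ x).symm c) ≠ 0 := fun h0 =>
        hc (by simpa using h.definite x _ h0)
      have him : (h.inner x ((φ x).symm c) ((φ x).symm c)).im = 0 :=
        Complex.conj_eq_iff_im.1 (h.conj_symm x _ _)
      have hre := h.nonneg x ((φ x).symm c)
      refine lt_of_le_of_ne (Complex.le_def.2 ⟨by simpa using hre, by simpa using him.symm⟩)
        hne.symm
  have hGc : ∀ x ∈ U, ContinuousAt G x := by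
    intro x hx
    have hec : ∀ i, ContinuousAt (fun x => (⟨x, e i x⟩ : Σ x, V.E x)) x := by
      intro i
      rw [hφ (e i) x hx]
      simp only [e, LinearEquiv.apply_symm_apply]
      exact continuousAt_const
    exact continuousAt_pi.2 fun i => continuousAt_pi.2 fun j => h.continuousAt_inner (hec i) (hec j)
  have hBG : ∀ x ∈ U, ContinuousAt (fun x => B (G x)) x := by
    intro x hx
    have h1 : Filter.Tendsto G (𝓝 x) (𝓝[{M | M.PosDef}] (G x)) :=
      tendsto_nhdsWithin_iff.2 ⟨hGc x hx, Filter.Eventually.of_forall hpd⟩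
    exact (hBc (G x) (hpd x)).tendsto.comp h1
  have hdet : ∀ x, IsUnit (B (G x)).det := fun x =>
    (Matrix.isUnit_iff_isUnit_det _).1 (hB _ (hpd x)).2
  have hBinv : ∀ x ∈ U, ContinuousAt (fun x => (B (G x))⁻¹) x := by
    intro x hx
    refine ContinuousAt.comp (g := Inv.inv) (continuousAt_matrix_inv _ ?_) (hBG x hx)
    rw [Ring.inverse_eq_inv']
    exact continuousAt_inv₀ (hdet x).ne_zero
  let ψ : ∀ x, V.E x ≃ₗ[ℂ] (Fin n → ℂ) := fun x =>
    (φ x).trans (Matrix.toLinearEquiv' (B (G x)) ((B (G x)).invertibleOfIsUnitDet (hdet x)))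
  have hψ : ∀ x v, ψ x v = B (G x) *ᵥ φ x v := fun _ _ => rfl
  refine ⟨U, hUo, hx₀, ψ, fun x u v => ?_, fun s x hx => ?_⟩
  · rw [hG, hψ, hψ]
    conv_lhs => rw [← (hB _ (hpd x)).1]
    rw [← Matrix.mulVec_mulVec, Matrix.star_mulVec, ← Matrix.dotProduct_mulVec]
  · have hmulVec : ∀ {A : X → Matrix (Fin n) (Fin n) ℂ} {c : X → Fin n → ℂ},
        ContinuousAt A x → ContinuousAt c x → ContinuousAt (fun x => A x *ᵥ c x) x := by
      intro A c hA hc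
      exact ContinuousAt.comp (f := fun x => (A x, c x))
        (g := fun p : Matrix (Fin n) (Fin n) ℂ × (Fin n → ℂ) => p.1 *ᵥ p.2)
        (continuous_fst.matrix_mulVec continuous_snd).continuousAt (hA.prodMk hc)
    rw [hφ s x hx]
    constructor
    · intro hc
      exact hmulVec (hBG x hx) hc
    · intro hc
      have h1 : (fun x => φ x (s x)) = fun x => (B (G x))⁻¹ *ᵥ ψ x (s x) := by
        funext y
        rw [hψ, Matrix.mulVec_mulVec, Matrix.nonsing_inv_mul _ (hdet y), Matrix.one_mulVec]
      rw [h1]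
      exact hmulVec (hBinv x hx) hc

/-- Over a second-countable locally compact Hausdorff space of
covering dimension at most `d`, every rank-`n` Hermitian vector bundle admits a
global frame of `(d+1)·n` bounded continuous sections: every fibre vector `v` is
reconstructed as `∑ k ⟨F k x, v⟩ • F k x`. -/
theorem exists_bounded_global_frame (X : Type) [TopologicalSpace X]
    [SecondCountableTopology X] [LocallyCompactSpace X] [T2Space X]
    (d : ℕ) (hdim : CoveringDimLE X d) (n : ℕ)
    (V : CplxVectorBundle X) (hV : V.HasRank n) (h : HermitianMetric V) :
    ∃ F : Fin ((d + 1) * n) → (∀ x, V.E x),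
      (∀ k, V.IsContinuousSection (F k)) ∧
      (∀ k, ∃ C : ℝ, ∀ x, h.fibNorm x (F k x) ≤ C) ∧
      (∀ (x : X) (v : V.E x), ∑ k, h.inner x (F k x) v • F k x = v) := by
  classical
  rcases isEmpty_or_nonempty X with hX | hX
  · exact ⟨fun _ _ => 0, fun _ => continuous_iff_continuousAt.2 fun x => isEmptyElim x,
      fun _ => ⟨0, fun x => isEmptyElim x⟩, fun x => isEmptyElim x⟩
  choose U hUo hmemU ψ hψ hcont using h.exists_orthonormal_coordinates hV
  obtain ⟨a, p, hac, hsum, hap⟩ := hdim.exists_functions U hUo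
    (Set.eq_univ_of_forall fun x => Set.mem_iUnion.2 ⟨x, hmemU x⟩)
  let f : Fin (d + 1) × Fin n → ∀ x, V.E x := fun k x =>
    (a k.1 x : ℂ) • (ψ (p k.1 x) x).symm (Pi.single k.2 1)
  have hψf : ∀ k x, ψ (p k.1 x) x (f k x) = (a k.1 x : ℂ) • Pi.single k.2 1 := fun k x => by
    simp only [f, map_smul, LinearEquiv.apply_symm_apply]
  have hself : ∀ k x, h.inner x (f k x) (f k x) = ((a k.1 x ^ 2 : ℝ) : ℂ) := by
    intro k x
    rw [hψ (p k.1 x), hψf]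
    simp [sq]
  have hcoord : ∀ z k x j, ‖ψ z x (f k x) j‖ ≤ |a k.1 x| := by
    intro z k x j
    have h1 : h.inner x (f k x) (f k x) = ((∑ i, ‖ψ z x (f k x) i‖ ^ 2 : ℝ) : ℂ) := by
      rw [hψ z]
      simp only [dotProduct, Pi.star_apply, Complex.ofReal_sum, Complex.ofReal_pow]
      exact Finset.sum_congr rfl fun i _ => Complex.conj_mul' _
    rw [hself, Complex.ofReal_inj] at h1
    refine abs_le_of_sq_le_sq' ?_ (abs_nonneg _) |>.2
    rw [sq_abs, h1]
    exact Finset.single_le_sum (f := fun i => ‖ψ z x (f k x) i‖ ^ 2)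
      (fun i _ => sq_nonneg _) (Finset.mem_univ j)
  refine ⟨fun k => f (finProdFinEquiv.symm k), fun k => ?_, fun k => ⟨1, fun x => ?_⟩,
    fun x v => ?_⟩
  · beta_reduce
    generalize finProdFinEquiv.symm k = k
    refine continuous_iff_continuousAt.2 fun x => ?_
    by_cases ha : a k.1 x = 0
    · rw [hcont x (f k) x (hmemU x)]
      refine continuousAt_pi.2 fun j => ?_
      have h0 : ψ x x (f k x) j = 0 := by
        simpa [ha] using hcoord x k x j
      rw [ContinuousAt, h0]
      refine squeeze_zero_norm (fun y => hcoord x k y j) ?_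
      have h1 := (hac k.1).abs.tendsto x
      rwa [ha, abs_zero] at h1
    · obtain ⟨hxU, hloc⟩ := hap k.1 x ha
      rw [hcont (p k.1 x) (f k) x hxU]
      have h1 : ContinuousAt (fun y => (a k.1 y : ℂ) • (Pi.single k.2 1 : Fin n → ℂ)) x :=
        (Complex.continuous_ofReal.comp (hac k.1)).continuousAt.smul continuousAt_const
      refine h1.congr ?_
      filter_upwards [hloc] with y hy
      rw [← hψf, hy]
  · beta_reduce
    generalize finProdFinEquiv.symm k = k
    rw [HermitianMetric.fibNorm, hself, Complex.ofReal_re]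
    refine Real.sqrt_le_one.2 ?_
    rw [← hsum x]
    exact Finset.single_le_sum (f := fun i => a i x ^ 2) (fun i _ => sq_nonneg _)
      (Finset.mem_univ k.1)
  · rw [finProdFinEquiv.symm.sum_comp (fun k => h.inner x (f k x) v • f k x),
      Fintype.sum_prod_type]
    have hterm : ∀ i, ∑ j, h.inner x (f (i, j) x) v • f (i, j) x = ((a i x ^ 2 : ℝ) : ℂ) • v := by
      intro i
      apply (ψ (p i x) x).injective
      have hψi : ∀ j, ψ (p i x) x (f (i, j) x) = (a i x : ℂ) • Pi.single j 1 := fun j =>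
        hψf (i, j) x
      simp only [map_sum, map_smul, hψ (p i x), hψi]
      ext j
      simp [Finset.sum_apply, Pi.single_apply]
      ring
    simp only [hterm]
    rw [← Finset.sum_smul, ← Complex.ofReal_sum, hsum, Complex.ofReal_one, one_smul]
end

section
/- Let X be a locally compact Hausdorff space and let ι : X → X^c be a compactification of X (so X^c is compact Hausdorff and ι is a dense open embedding). Let A = C₀(X,ℂ) and A_b = C(X^c,ℂ), which acts on A via the restriction homomorphism C(X^c,ℂ) → C_b(X,ℂ). Then for a C₀(X,ℂ)-module E, the following are equivalent: (i) there exist n ∈ ℕ and a projection p ∈ M_n(C(X^c,ℂ)) such that E is isomorphic as a C₀(X,ℂ)-module to p·C₀(X)^n; (ii) there is a locally trivial complex vector bundle V of finite rank over X^c, equipped with a Hermitian metric, such that E is isomorphic as a C₀(X,ℂ)-module to Γ₀(X, V|_X), where V|_X is the pullback of V along ι. -/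
open Filter Topology

open scoped ComplexOrder in
theorem Matrix.exists_continuousOn_inv_sqrt (n : ℕ) :
    ∃ R : Matrix (Fin n) (Fin n) ℂ → Matrix (Fin n) (Fin n) ℂ,
      ContinuousOn R {G | G.PosDef} ∧
      ∀ G, G.PosDef → star (R G) = R G ∧ R G * R G * G = 1 := by
  open scoped Matrix.Norms.L2Operator MatrixOrder in
  refine ⟨fun G => G ^ (-(1/2) : ℝ), ?_, fun G hG => ?_⟩
  · have := CFC.continuousOn_rpow (A := Matrix (Fin n) (Fin n) ℂ) (-(1/2) : ℝ)
    refine ContinuousOn.mono this ?_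
    intro G hG
    exact Matrix.PosDef.isStrictlyPositive hG
  · have h := Matrix.PosDef.isStrictlyPositive hG
    refine ⟨CFC.rpow_nonneg.isSelfAdjoint, ?_⟩
    rw [← CFC.rpow_add h.isUnit]
    norm_num
    have := CFC.rpow_neg_mul_rpow 1 h
    rwa [CFC.rpow_one G] at this

theorem Matrix.isOpen_and_continuousOn_inv {n : ℕ} {Y : Type*} [TopologicalSpace Y]
    {A : Y → Matrix (Fin n) (Fin n) ℂ} (hA : Continuous A) :
    IsOpen {y | IsUnit (A y).det} ∧ ContinuousOn (fun y => (A y)⁻¹) {y | IsUnit (A y).det} := by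
  have hd : Continuous fun y => (A y).det := hA.matrix_det
  constructor
  · simp only [isUnit_iff_ne_zero]
    exact isOpen_ne.preimage hd
  · simp only [isUnit_iff_ne_zero, Matrix.inv_def, Ring.inverse_eq_inv']
    exact (hd.continuousOn.inv₀ fun y hy => hy).smul hA.matrix_adjugate.continuousOn

namespace HermitianMetric

variable {Y : Type} [TopologicalSpace Y] {W : CplxVectorBundle Y} (h : HermitianMetric W)

/-- The sesquilinear form of a Hermitian metric is linear in the second variable. -/
def innerRight (y : Y) (u : W.E y) : W.E y →ₗ[ℂ] ℂ where
  toFun := h.inner y u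
  map_add' := h.add_right y u
  map_smul' c v := h.smul_right y c u v

theorem inner_sum_smul_right {κ : Type*} (s : Finset κ) (y : Y) (u : W.E y) (c : κ → ℂ)
    (v : κ → W.E y) :
    h.inner y u (∑ k ∈ s, c k • v k) = ∑ k ∈ s, c k * h.inner y u (v k) := by
  have := map_sum (h.innerRight y u) (fun k => c k • v k) s
  simp only [map_smul] at this
  exact this

theorem inner_sum_smul_left {κ : Type*} (s : Finset κ) (y : Y) (u : W.E y) (c : κ → ℂ)
    (v : κ → W.E y) :
    h.inner y (∑ k ∈ s, c k • v k) u = ∑ k ∈ s, star (c k) * h.inner y (v k) u := by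
  rw [← h.conj_symm, inner_sum_smul_right, map_sum]
  simp [h.conj_symm]

theorem inner_smul_left (y : Y) (c : ℂ) (u v : W.E y) :
    h.inner y (c • u) v = star c * h.inner y u v := by
  simpa using h.inner_sum_smul_left {()} y v (fun _ => c) fun _ => u

theorem inner_self_im (y : Y) (v : W.E y) : (h.inner y v v).im = 0 :=
  Complex.conj_eq_iff_im.mp (h.conj_symm y v v)

theorem continuousOn_inner {Z : Type*} [TopologicalSpace Z] {f : Z → Y} {S : Set Z}
    {s t : ∀ z, W.E (f z)}
    (hs : ContinuousOn (fun z => (⟨f z, s z⟩ : Σ y, W.E y)) S)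
    (ht : ContinuousOn (fun z => (⟨f z, t z⟩ : Σ y, W.E y)) S) :
    ContinuousOn (fun z => h.inner (f z) (s z) (t z)) S := by
  rw [continuousOn_iff_continuous_domRestrict] at *
  exact h.continuous_inner.comp ((hs.prodMk ht).subtype_mk fun _ => rfl)

end HermitianMetric

/-- Around every point a vector bundle has a local frame `e`, extended by zero; sections with
continuous coordinates with respect to `e` are continuous. -/
theorem CplxVectorBundle.exists_local_frame {Y : Type} [TopologicalSpace Y]
    (W : CplxVectorBundle Y) (y₀ : Y) :
    ∃ (n : ℕ) (U : Set Y) (e : Fin n → ∀ y, W.E y), IsOpen U ∧ y₀ ∈ U ∧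
      (∀ y ∈ U, ∀ v : W.E y, ∃ c : Fin n → ℂ, v = ∑ i, c i • e i y) ∧
      (∀ y ∈ U, ∀ c : Fin n → ℂ, ∑ i, c i • e i y = 0 → c = 0) ∧
      ∀ (Z : Type) [TopologicalSpace Z] (f : Z → Y) (S : Set Z) (c : Z → Fin n → ℂ),
        ContinuousOn f S → ContinuousOn c S → Set.MapsTo f S U →
        ContinuousOn (fun z => (⟨f z, ∑ i, c z i • e i (f z)⟩ : Σ y, W.E y)) S := by
  classical
  obtain ⟨n, U, hU, hy₀, φ, hφ⟩ := W.locTriv y₀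
  have key : ∀ y (hy : y ∈ U) (c : Fin n → ℂ),
      ∑ i, c i • (if hy : y ∈ U then (φ y hy).symm (Pi.single i 1) else 0) =
        (φ y hy).symm c := by
    intro y hy c
    simp only [hy, dite_true, ← map_smul, ← map_sum]
    congr 1
    ext j
    simp [Finset.sum_apply, Pi.single_apply]
  refine ⟨n, U, fun i y => if hy : y ∈ U then (φ y hy).symm (Pi.single i 1) else 0, hU, hy₀,
    fun y hy v => ⟨φ y hy v, ?_⟩, fun y hy c hc => ?_, fun Z _ f S c hf hc hfU => ?_⟩
  · rw [key y hy]; simp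
  · rw [key y hy] at hc; simpa using hc
  · rw [continuousOn_iff_continuous_domRestrict] at *
    have := continuous_subtype_val.comp (hφ.homeomorph.symm.continuous.comp
      ((hf.subtype_mk fun z => hfU z.2).prodMk hc))
    refine this.congr fun z => ?_
    simp only [Function.comp_apply, Set.domRestrict_apply]
    rw [key _ (hfU z.2)]
    have : hφ.homeomorph.symm (⟨f z, hfU z.2⟩, c z) =
        ⟨⟨f z, (φ _ (hfU z.2)).symm (c z)⟩, hfU z.2⟩ := by
      rw [Homeomorph.symm_apply_eq]
      simp
    exact congrArg Subtype.val this

open scoped ComplexOrder in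
/-- Around every point a Hermitian vector bundle has a local orthonormal frame `τ`; we only
record the resulting reconstruction formula. -/
theorem HermitianMetric.exists_local_parseval_frame {Y : Type} [TopologicalSpace Y]
    {W : CplxVectorBundle Y} (h : HermitianMetric W) (y₀ : Y) :
    ∃ (n : ℕ) (U : Set Y) (τ : Fin n → ∀ y, W.E y), IsOpen U ∧ y₀ ∈ U ∧
      (∀ y ∈ U, ∀ v : W.E y, v = ∑ i, h.inner y (τ i y) v • τ i y) ∧
      (∀ i, ContinuousOn (fun y => (⟨y, τ i y⟩ : Σ y, W.E y)) U) ∧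
      ∀ (Z : Type) [TopologicalSpace Z] (f : Z → Y) (S : Set Z) (s : ∀ z, W.E (f z)),
        ContinuousOn f S → Set.MapsTo f S U →
        (∀ i, ContinuousOn (fun z => h.inner (f z) (τ i (f z)) (s z)) S) →
        ContinuousOn (fun z => (⟨f z, s z⟩ : Σ y, W.E y)) S := by
  obtain ⟨n, U, e, hU, hy₀, hspan, hind, hcont⟩ := W.exists_local_frame y₀
  obtain ⟨R, hR, hRs⟩ := Matrix.exists_continuousOn_inv_sqrt n
  let G : Y → Matrix (Fin n) (Fin n) ℂ := fun y => Matrix.of fun i j => h.inner y (e i y) (e j y)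
  have he : ∀ i, ContinuousOn (fun y => (⟨y, e i y⟩ : Σ y, W.E y)) U := fun i => by
    have := hcont Y id U (fun _ => Pi.single i 1) continuousOn_id continuousOn_const
      (Set.mapsTo_id U)
    simpa [Pi.single_apply] using this
  have hG : ContinuousOn G U := by
    refine continuousOn_pi.2 fun i => continuousOn_pi.2 fun j => ?_
    exact h.continuousOn_inner (he i) (he j)
  have hGc : ∀ y (c d : Fin n → ℂ), h.inner y (∑ i, c i • e i y) (∑ i, d i • e i y) =
      star c ⬝ᵥ (G y).mulVec d := by
    intro y c d
    simp only [h.inner_sum_smul_left, h.inner_sum_smul_right, dotProduct, Matrix.mulVec, G,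
      Matrix.of_apply, Pi.star_apply]
    simp only [mul_comm]
  have hGp : ∀ y ∈ U, (G y).PosDef := by
    intro y hy
    refine Matrix.PosDef.of_dotProduct_mulVec_pos ?_ fun c hc => ?_
    · ext i j
      exact h.conj_symm y _ _
    · rw [← hGc, Complex.lt_def]
      refine ⟨lt_of_le_of_ne (h.nonneg y _) fun h0 => hc (hind y hy c (h.definite y _ ?_)),
        (h.inner_self_im y _).symm⟩
      exact Complex.ext h0.symm (h.inner_self_im y _)
  have hRc : ContinuousOn (fun y => R (G y)) U := hR.comp hG hGp
  have hrec : ∀ y (a : Fin n → ℂ), ∑ j, a j • ∑ i, R (G y) i j • e i y =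
      ∑ i, ((R (G y)).mulVec a) i • e i y := by
    intro y a
    simp only [Finset.smul_sum, Matrix.mulVec, dotProduct, Finset.sum_smul, smul_smul]
    rw [Finset.sum_comm]
    simp only [mul_comm]
  have hpar : ∀ y ∈ U, ∀ v : W.E y, v = ∑ j, h.inner y (∑ i, R (G y) i j • e i y) v •
      ∑ i, R (G y) i j • e i y := by
    intro y hy v
    obtain ⟨c, rfl⟩ := hspan y hy v
    obtain ⟨h1, h2⟩ := hRs _ (hGp y hy)
    have h3 : ∀ j, h.inner y (∑ i, R (G y) i j • e i y) (∑ i, c i • e i y) =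
        (R (G y)).mulVec ((G y).mulVec c) j := by
      intro j
      rw [hGc]
      conv_rhs => rw [← h1]
      rfl
    simp only [h3]
    rw [hrec]
    simp only [Matrix.mulVec_mulVec, ← mul_assoc, h2, Matrix.one_mulVec]
  refine ⟨n, U, fun j y => ∑ i, R (G y) i j • e i y, hU, hy₀, hpar, fun j => ?_,
    fun Z _ f S s hf hfU hs => ?_⟩
  · refine hcont Y id U (fun y i => R (G y) i j) continuousOn_id ?_ (Set.mapsTo_id U)
    exact continuousOn_pi.2 fun i => (continuousOn_pi.1 (continuousOn_pi.1 hRc i) j)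
  · have hRf : ContinuousOn (fun z => R (G (f z))) S := hRc.comp hf hfU
    have hc : ContinuousOn (fun z => (R (G (f z))).mulVec
        fun j => h.inner (f z) (∑ i, R (G (f z)) i j • e i (f z)) (s z)) S := by
      refine continuousOn_pi.2 fun i => ?_
      simp only [Matrix.mulVec, dotProduct]
      exact continuousOn_finsetSum _ fun j _ =>
        (continuousOn_pi.1 (continuousOn_pi.1 hRf i) j).mul (hs j)
    refine (hcont Z f S _ hf hc hfU).congr fun z hz => ?_
    have := hpar _ (hfU hz) (s z)
    rw [hrec] at this
    exact congrArg (Sigma.mk (f z)) this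

/-- Over a compact Hausdorff space, a Hermitian vector bundle has a finite Parseval frame of
continuous sections, and continuity of sections along a map can be checked on the coefficients. -/
theorem HermitianMetric.exists_parseval_frame {Y : Type} [TopologicalSpace Y] [CompactSpace Y]
    [T2Space Y] {W : CplxVectorBundle Y} (h : HermitianMetric W) :
    ∃ (n : ℕ) (σ : Fin n → ∀ y, W.E y),
      (∀ y, ∀ v : W.E y, v = ∑ i, h.inner y (σ i y) v • σ i y) ∧
      (∀ i, W.IsContinuousSection (σ i)) ∧
      ∀ (Z : Type) [TopologicalSpace Z] (f : Z → Y) (s : ∀ z, W.E (f z)), Continuous f →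
        (∀ i, Continuous fun z => h.inner (f z) (σ i (f z)) (s z)) →
        Continuous fun z => (⟨f z, s z⟩ : Σ y, W.E y) := by
  choose n U τ hU hmem hpar hτ hcont using h.exists_local_parseval_frame
  obtain ⟨t, ht⟩ := CompactSpace.elim_nhds_subcover U fun y => (hU y).mem_nhds (hmem y)
  obtain ⟨ρ, hρ⟩ := PartitionOfUnity.exists_isSubordinate isClosed_univ (fun k : t => U k)
    (fun k => hU k) (by
      intro y _
      have : y ∈ ⋃ x ∈ t, U x := ht ▸ Set.mem_univ y
      simpa using this)
  have hsum : ∀ y, ∑ k, ρ k y = 1 := fun y => by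
    rw [← finsum_eq_sum_of_fintype]
    exact ρ.sum_eq_one (Set.mem_univ y)
  let r : t → Y → ℂ := fun k y => (Real.sqrt (ρ k y) : ℂ)
  have hr : ∀ k, Continuous (r k) := fun k =>
    Complex.continuous_ofReal.comp (Real.continuous_sqrt.comp (ρ k).continuous)
  have hrr : ∀ k y, r k y * r k y = (ρ k y : ℂ) := fun k y => by
    rw [← Complex.ofReal_mul, Real.mul_self_sqrt (ρ.nonneg k y)]
  have hrz : ∀ k y, ρ k y = 0 → r k y = 0 := fun k y h0 => by simp [r, h0]
  have hrU : ∀ k, tsupport (r k) ⊆ U k := fun k =>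
    (closure_mono (show Function.support (r k) ⊆ Function.support (ρ k) from
      fun y hy h0 => hy (hrz k y h0))).trans (hρ k)
  have hrstar : ∀ k y, star (r k y) = r k y := fun k y => Complex.conj_ofReal _
  let σ : (Σ k : t, Fin (n k)) → ∀ y, W.E y := fun a y => r a.1 y • τ a.1 a.2 y
  have hσpar : ∀ y, ∀ v : W.E y, v = ∑ a, h.inner y (σ a y) v • σ a y := by
    intro y v
    rw [Fintype.sum_sigma]
    have : ∀ k : t, ∑ i, h.inner y (σ ⟨k, i⟩ y) v • σ ⟨k, i⟩ y = (ρ k y : ℂ) • v := by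
      intro k
      simp only [σ, h.inner_smul_left, hrstar, smul_smul]
      by_cases hy : y ∈ U k
      · conv_rhs => rw [hpar k y hy v]
        rw [Finset.smul_sum]
        refine Finset.sum_congr rfl fun i _ => ?_
        rw [smul_smul, ← hrr]
        ring_nf
      · have h0 : ρ k y = 0 := image_eq_zero_of_notMem_tsupport fun hy' => hy (hρ k hy')
        simp [hrz k y h0, h0]
    simp only [this]
    rw [← Finset.sum_smul, ← Complex.ofReal_sum, hsum, Complex.ofReal_one, one_smul]
  have hσcont : ∀ (Z : Type) [TopologicalSpace Z] (f : Z → Y) (s : ∀ z, W.E (f z)),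
      Continuous f → (∀ a, Continuous fun z => h.inner (f z) (σ a (f z)) (s z)) →
      Continuous fun z => (⟨f z, s z⟩ : Σ y, W.E y) := by
    intro Z _ f s hf hs
    refine continuous_iff_continuousAt.2 fun z₀ => ?_
    obtain ⟨k, hk⟩ : ∃ k, r k (f z₀) ≠ 0 := by
      by_contra! hc
      have : ∑ k, (ρ k (f z₀) : ℂ) = 0 := Finset.sum_eq_zero fun k _ => by rw [← hrr, hc, zero_mul]
      rw [← Complex.ofReal_sum, hsum] at this
      simp at this
    have hopen : IsOpen {z | r k (f z) ≠ 0} := isOpen_ne.preimage ((hr k).comp hf)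
    refine (hcont k Z f {z | r k (f z) ≠ 0} s hf.continuousOn
      (fun z hz => hrU k (subset_tsupport _ hz)) fun i => ?_).continuousAt (hopen.mem_nhds hk)
    refine ContinuousOn.congr (f := fun z => (r k (f z))⁻¹ * h.inner (f z) (σ ⟨k, i⟩ (f z)) (s z))
      ((((hr k).comp hf).continuousOn.inv₀ fun z hz => hz).mul (hs ⟨k, i⟩).continuousOn)
      fun z hz => ?_
    simp only [σ, h.inner_smul_left, hrstar]
    rw [inv_mul_cancel_left₀ hz]
  have hσ : ∀ a, W.IsContinuousSection (σ a) := by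
    rintro ⟨l, j⟩
    refine hσcont Y id _ continuous_id fun ⟨k, i⟩ => ?_
    have heq : (fun y => h.inner y (σ ⟨k, i⟩ y) (σ ⟨l, j⟩ y)) =
        fun y => (r k y * r l y) * h.inner y (τ k i y) (τ l j y) := by
      funext y
      simp only [σ, h.inner_smul_left, hrstar, h.smul_right]
      ring
    change Continuous fun y => h.inner y (σ ⟨k, i⟩ y) (σ ⟨l, j⟩ y)
    rw [heq]
    refine ContinuousOn.continuous_of_tsupport_subset (s := U k ∩ U l) ?_
      ((hU k).inter (hU l)) ?_
    · exact ((hr k).mul (hr l)).continuousOn.mul (h.continuousOn_inner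
        ((hτ k i).mono Set.inter_subset_left) ((hτ l j).mono Set.inter_subset_right))
    · refine Set.subset_inter (Set.Subset.trans (closure_mono ?_) (hrU k))
        (Set.Subset.trans (closure_mono ?_) (hrU l))
      · exact fun y hy h0 => hy (by simp [h0])
      · exact fun y hy h0 => hy (by simp [h0])
  let ε := Fintype.equivFin (Σ k : t, Fin (n k))
  refine ⟨_, fun i => σ (ε.symm i), fun y v => ?_, fun i => hσ _, fun Z _ f s hf hs =>
    hσcont Z f s hf fun a => by simpa using hs (ε a)⟩
  rw [Equiv.sum_comp ε.symm fun a => h.inner y (σ a y) v • σ a y]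
  exact hσpar y v

theorem HermitianMetric.fibNorm_eq_of_parseval {Y : Type} [TopologicalSpace Y]
    {W : CplxVectorBundle Y} (h : HermitianMetric W) {n : ℕ} {y : Y} {σ : Fin n → W.E y}
    {v : W.E y} (hv : v = ∑ i, h.inner y (σ i) v • σ i) :
    h.fibNorm y v = Real.sqrt (∑ i, ‖h.inner y (σ i) v‖ ^ 2) := by
  have : h.inner y v v = ∑ i, star (h.inner y (σ i) v) * h.inner y (σ i) v := by
    conv_lhs => rw [hv]
    rw [h.inner_sum_smul_left, ← hv]
  rw [HermitianMetric.fibNorm, this]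
  congr 1
  rw [Complex.re_sum]
  refine Finset.sum_congr rfl fun i _ => ?_
  rw [← starRingEnd_apply, ← Complex.normSq_eq_conj_mul_self, Complex.ofReal_re,
    Complex.normSq_eq_norm_sq]

theorem tendsto_sqrt_sum_sq_zero_iff {α : Type*} {n : ℕ} {l : Filter α} {c : α → Fin n → ℂ} :
    Tendsto (fun x => Real.sqrt (∑ i, ‖c x i‖ ^ 2)) l (𝓝 0) ↔
      ∀ i, Tendsto (fun x => c x i) l (𝓝 0) := by
  constructor
  · intro hc i
    refine squeeze_zero_norm (fun x => ?_) hc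
    exact Real.le_sqrt_of_sq_le (Finset.single_le_sum (f := fun i => ‖c x i‖ ^ 2)
      (fun _ _ => by positivity) (Finset.mem_univ i))
  · intro hc
    have : Tendsto (fun x => Real.sqrt (∑ i, ‖c x i‖ ^ 2)) l
        (𝓝 (Real.sqrt (∑ _i : Fin n, 0))) := by
      refine (Real.continuous_sqrt.tendsto _).comp (tendsto_finsetSum _ fun i _ => ?_)
      simpa using (hc i).norm.pow 2
    simpa using this

section ImageBundle

variable {Y : Type} [TopologicalSpace Y] {n : ℕ}

/-- The image of a projection matrix, as the space of its fixed vectors. -/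
def Matrix.fixedSpace (A : Matrix (Fin n) (Fin n) ℂ) : Submodule ℂ (Fin n → ℂ) :=
  LinearMap.eqLocus A.mulVecLin LinearMap.id

theorem Matrix.mem_fixedSpace {A : Matrix (Fin n) (Fin n) ℂ} {v : Fin n → ℂ} :
    v ∈ A.fixedSpace ↔ A.mulVec v = v := Iff.rfl

theorem Matrix.mul_intertwiner {P Q : Matrix (Fin n) (Fin n) ℂ} (hP : P * P = P)
    (hQ : Q * Q = Q) :
    (P * Q + (1 - P) * (1 - Q)) * Q = P * (P * Q + (1 - P) * (1 - Q)) := by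
  have h1 : (1 - Q) * Q = 0 := by rw [sub_mul, one_mul, hQ, sub_self]
  have h2 : P * (1 - P) = 0 := by rw [mul_sub, mul_one, hP, sub_self]
  rw [add_mul, mul_assoc, mul_assoc, hQ, h1, mul_add, ← mul_assoc, ← mul_assoc, hP, h2]
  simp

/-- If `B` is invertible with `B Q = P B`, it maps the image of `Q` isomorphically onto that
of `P`. -/
noncomputable def Matrix.fixedSpaceEquiv {P Q B : Matrix (Fin n) (Fin n) ℂ}
    (hB : IsUnit B.det) (hBQ : B * Q = P * B) : Q.fixedSpace ≃ₗ[ℂ] P.fixedSpace :=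
  LinearEquiv.ofLinearMap
    (B.mulVecLin.restrict fun v hv => by
      rw [mem_fixedSpace] at hv ⊢
      rw [mulVecLin_apply, mulVec_mulVec, ← hBQ, ← mulVec_mulVec, hv])
    (B⁻¹.mulVecLin.restrict fun v hv => by
      have : Q * B⁻¹ = B⁻¹ * P := by
        rw [← nonsing_inv_mul_cancel_left B (Q * B⁻¹) hB, ← mul_assoc B, hBQ, mul_assoc P,
          mul_nonsing_inv B hB, mul_one]
      rw [mem_fixedSpace] at hv ⊢
      rw [mulVecLin_apply, mulVec_mulVec, this, ← mulVec_mulVec, hv])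
    (by ext v : 2; simp [LinearMap.restrict_apply, mul_nonsing_inv B hB])
    (by ext v : 2; simp [LinearMap.restrict_apply, nonsing_inv_mul B hB])

/-- The vector bundle of images of a continuous family of idempotent matrices, with the subspace
topology from `Y × ℂⁿ`. -/
noncomputable def CplxVectorBundle.ofIdempotent (p : C(Y, Matrix (Fin n) (Fin n) ℂ))
    (hp : ∀ y, p y * p y = p y) : CplxVectorBundle Y where
  E y := (p y).fixedSpace
  topTotal := TopologicalSpace.induced
    (fun q => ((q.1, (q.2 : Fin n → ℂ)) : Y × (Fin n → ℂ))) inferInstance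
  locTriv y₀ := by
    let _ : TopologicalSpace (Σ y, (p y).fixedSpace) := TopologicalSpace.induced
      (fun q => ((q.1, (q.2 : Fin n → ℂ)) : Y × (Fin n → ℂ))) inferInstance
    have hind : IsInducing (fun q : Σ y, (p y).fixedSpace =>
      ((q.1, (q.2 : Fin n → ℂ)) : Y × (Fin n → ℂ))) := ⟨rfl⟩
    have hfst : Continuous (fun q : Σ y, (p y).fixedSpace => q.1) := hind.continuous.fst
    have hsnd : Continuous (fun q : Σ y, (p y).fixedSpace => (q.2 : Fin n → ℂ)) :=
      hind.continuous.snd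
    let B : Y → Matrix (Fin n) (Fin n) ℂ := fun y => p y₀ * p y + (1 - p y₀) * (1 - p y)
    have hB : Continuous B := by fun_prop
    have hB₀ : B y₀ = 1 := by
      simp only [B, hp, mul_sub, sub_mul, one_mul, mul_one]
      abel
    obtain ⟨hU, hinv⟩ := Matrix.isOpen_and_continuousOn_inv hB
    let b := Module.finBasis ℂ (p y₀).fixedSpace
    let β := b.equivFunL
    let ψ : ∀ y, y ∈ {y | IsUnit (B y).det} → (p y).fixedSpace ≃ₗ[ℂ] (p y₀).fixedSpace :=
      fun y hy => Matrix.fixedSpaceEquiv hy (Matrix.mul_intertwiner (hp y₀) (hp y))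
    refine ⟨_, {y | IsUnit (B y).det}, hU, by simp [hB₀],
      fun y hy => (ψ y hy).trans β.toLinearEquiv, ?_⟩
    rw [isHomeomorph_iff_exists_inverse]
    refine ⟨?_, fun q => ⟨⟨q.1.1, (ψ q.1.1 q.1.2).symm (β.symm q.2)⟩, q.1.2⟩, ?_, ?_, ?_⟩
    · refine ((hfst.comp continuous_subtype_val).subtype_mk _).prodMk ?_
      refine β.continuous.comp (Continuous.subtype_mk ?_ _)
      exact (hB.comp (hfst.comp continuous_subtype_val)).matrix_mulVec
        (hsnd.comp continuous_subtype_val)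
    · rintro ⟨⟨y, v⟩, hy⟩
      simp
    · rintro ⟨⟨y, hy⟩, c⟩
      simp
    · refine Continuous.subtype_mk (hind.continuous_iff.2 ?_) _
      refine (continuous_subtype_val.comp continuous_fst).prodMk ?_
      refine Continuous.matrix_mulVec (A := fun q : {y | IsUnit (B y).det} × _ => (B q.1.1)⁻¹)
        ((continuousOn_iff_continuous_domRestrict.1 hinv).comp continuous_fst) ?_
      exact continuous_subtype_val.comp (β.symm.continuous.comp continuous_snd)

variable (p : C(Y, Matrix (Fin n) (Fin n) ℂ)) (hp : ∀ y, p y * p y = p y)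

theorem CplxVectorBundle.isInducing_ofIdempotent :
    IsInducing (fun q : Σ y, (ofIdempotent p hp).E y =>
      ((q.1, (show (p q.1).fixedSpace from q.2).1) : Y × (Fin n → ℂ))) := ⟨rfl⟩

/-- The Hermitian metric on the image bundle inherited from `ℂⁿ`. -/
noncomputable def HermitianMetric.ofIdempotent :
    HermitianMetric (CplxVectorBundle.ofIdempotent p hp) where
  inner y u v := star (show (p y).fixedSpace from u).1 ⬝ᵥ (show (p y).fixedSpace from v).1
  conj_symm y u v := by
    rw [starRingEnd_apply, Matrix.star_dotProduct, star_star]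
  add_right y u v w := dotProduct_add _ _ _
  smul_right y c u v := dotProduct_smul _ _ _
  nonneg y v := by
    open scoped ComplexOrder in
    exact (Complex.le_def.1 (dotProduct_star_self_nonneg (show (p y).fixedSpace from v).1)).1
  definite y v hv := by
    open scoped ComplexOrder in
    exact Subtype.ext (dotProduct_star_self_eq_zero.1 hv)
  continuous_inner := by
    have hcont := (CplxVectorBundle.isInducing_ofIdempotent p hp).continuous.snd
    have hcast : ∀ (a b : Σ y, (CplxVectorBundle.ofIdempotent p hp).E y) (hab : a.1 = b.1),
        (show (p a.1).fixedSpace from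
          cast (congrArg (CplxVectorBundle.ofIdempotent p hp).E hab).symm b.2).1 =
        (show (p b.1).fixedSpace from b.2).1 := by
      rintro ⟨x, u⟩ ⟨y, v⟩ hab
      cases hab
      rfl
    refine (((hcont.comp (continuous_fst.comp continuous_subtype_val)).star).dotProduct
      (hcont.comp (continuous_snd.comp continuous_subtype_val))).congr fun q => ?_
    exact congrArg _ (hcast _ _ q.2).symm

theorem HermitianMetric.fibNorm_ofIdempotent (y : Y)
    (v : (CplxVectorBundle.ofIdempotent p hp).E y) :
    (ofIdempotent p hp).fibNorm y v =
      Real.sqrt (∑ i, ‖(show (p y).fixedSpace from v).1 i‖ ^ 2) := by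
  rw [HermitianMetric.fibNorm]
  congr 1
  simp only [ofIdempotent, dotProduct, Complex.re_sum]
  refine Finset.sum_congr rfl fun i _ => ?_
  rw [Pi.star_apply, ← starRingEnd_apply, ← Complex.normSq_eq_conj_mul_self, Complex.ofReal_re,
    Complex.normSq_eq_norm_sq]

end ImageBundle

open ZeroAtInfty in
/-- non-unital Serre–Swan relative to a compactification.
For a locally compact Hausdorff `X` with compactification `ι : X → Xc` and a
`C₀(X,ℂ)`-module `E`: `E ≅ p·C₀(X)^n` for a projection `p ∈ Mₙ(C(Xc,ℂ))` iff `E` is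
isomorphic to `Γ₀(X, V|_X)` for a Hermitian vector bundle `V` over `Xc`. -/
theorem nonunital_serre_swan_compactification
    (X Xc : Type) [TopologicalSpace X] [LocallyCompactSpace X] [T2Space X]
    [TopologicalSpace Xc] [CompactSpace Xc] [T2Space Xc]
    (ι : X → Xc) (hemb : Topology.IsEmbedding ι) (hdense : DenseRange ι)
    (E : Type) [AddCommGroup E] [SMul C₀(X, ℂ) E]
    (hsmul_add : ∀ (a : C₀(X, ℂ)) (e f : E), a • (e + f) = a • e + a • f)
    (hadd_smul : ∀ (a b : C₀(X, ℂ)) (e : E), (a + b) • e = a • e + b • e)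
    (hmul_smul : ∀ (a b : C₀(X, ℂ)) (e : E), (a * b) • e = a • (b • e)) :
    (∃ (n : ℕ) (p : C(Xc, Matrix (Fin n) (Fin n) ℂ)),
        (∀ y, p y * p y = p y ∧ star (p y) = p y) ∧
        ∃ Φ : E → (Fin n → C₀(X, ℂ)),
          Function.Injective Φ ∧
          (∀ e f, Φ (e + f) = Φ e + Φ f) ∧
          (∀ (a : C₀(X, ℂ)) (e : E) (i : Fin n), Φ (a • e) i = a * Φ e i) ∧
          Set.range Φ = {v | ∀ (i : Fin n) (x : X), (∑ j, p (ι x) i j * v j x) = v i x}) ↔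
      (∃ (W : CplxVectorBundle Xc) (h : HermitianMetric W),
        ∃ Φ : E → (∀ x : X, W.E (ι x)),
          Function.Injective Φ ∧
          (∀ e f, Φ (e + f) = Φ e + Φ f) ∧
          (∀ (a : C₀(X, ℂ)) (e : E) (x : X), Φ (a • e) x = a x • Φ e x) ∧
          Set.range Φ = {s | (Continuous fun x => (⟨ι x, s x⟩ : Σ y, W.E y)) ∧
            Tendsto (fun x => h.fibNorm (ι x) (s x)) (cocompact X) (𝓝 0)}) := by
  constructor
  · rintro ⟨n, p, hp, Φ, hinj, hadd, hsmul, hrange⟩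
    have hmem : ∀ e x, (fun i => Φ e i x) ∈ (p (ι x)).fixedSpace := fun e x => by
      have : Φ e ∈ Set.range Φ := ⟨e, rfl⟩
      rw [hrange] at this
      exact funext fun i => this i x
    have hp' : ∀ y, p y * p y = p y := fun y => (hp y).1
    have hind := CplxVectorBundle.isInducing_ofIdempotent p hp'
    refine ⟨.ofIdempotent p hp', .ofIdempotent p hp', fun e x => ⟨fun i => Φ e i x, hmem e x⟩,
      fun e f hef => hinj ?_, fun e f => ?_, fun a e x => ?_, ?_⟩
    · funext i
      ext x
      exact congrFun (congrArg Subtype.val (congrFun hef x)) i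
    · funext x
      refine Subtype.ext (funext fun i => ?_)
      simp only [hadd]
      rfl
    · refine Subtype.ext (funext fun i => ?_)
      simp only [hsmul]
      rfl
    · refine Set.Subset.antisymm ?_ ?_
      · rintro _ ⟨e, rfl⟩
        refine ⟨hind.continuous_iff.2 (hemb.continuous.prodMk
          (continuous_pi fun i => (Φ e i).continuous)), ?_⟩
        exact (tendsto_sqrt_sum_sq_zero_iff.2 fun i => (Φ e i).zero_at_infty').congr fun x =>
          (HermitianMetric.fibNorm_ofIdempotent p hp' (ι x) ⟨fun i => Φ e i x, hmem e x⟩).symm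
      · rintro s ⟨hs, hs0⟩
        have hsc := hind.continuous.snd.comp hs
        simp only [HermitianMetric.fibNorm_ofIdempotent] at hs0
        have hs0' := tendsto_sqrt_sum_sq_zero_iff.1 hs0
        let v : Fin n → C₀(X, ℂ) := fun i =>
          ⟨⟨fun x => (show (p (ι x)).fixedSpace from s x).1 i, (continuous_pi_iff.1 hsc i)⟩, hs0' i⟩
        have hv : v ∈ Set.range Φ := by
          rw [hrange]
          exact fun i x => congrFun (show (p (ι x)).fixedSpace from s x).2 i
        obtain ⟨e, he⟩ := hv
        refine ⟨e, funext fun x => Subtype.ext (funext fun i => ?_)⟩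
        exact congrArg (fun w : Fin n → C₀(X, ℂ) => w i x) he
  · rintro ⟨W, h, Φ, hinj, hadd, hsmul, hrange⟩
    obtain ⟨n, σ, hpar, hσ, hcont⟩ := h.exists_parseval_frame
    have hcoef : ∀ s : ∀ x, W.E (ι x), Continuous (fun x => (⟨ι x, s x⟩ : Σ y, W.E y)) →
        ∀ i, Continuous fun x => h.inner (ι x) (σ i (ι x)) (s x) := fun s hs i =>
      continuousOn_univ.1 (h.continuousOn_inner
        ((hσ i).comp hemb.continuous).continuousOn hs.continuousOn)
    have hnorm : ∀ x (v : W.E (ι x)), h.fibNorm (ι x) v =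
        Real.sqrt (∑ i, ‖h.inner (ι x) (σ i (ι x)) v‖ ^ 2) := fun x v =>
      h.fibNorm_eq_of_parseval (hpar (ι x) v)
    simp only [hnorm, tendsto_sqrt_sum_sq_zero_iff] at hrange
    have hmem : ∀ e, (Continuous fun x => (⟨ι x, Φ e x⟩ : Σ y, W.E y)) ∧
        ∀ i, Tendsto (fun x => h.inner (ι x) (σ i (ι x)) (Φ e x)) (cocompact X) (𝓝 0) :=
      fun e => by
        have : Φ e ∈ Set.range Φ := ⟨e, rfl⟩
        rwa [hrange] at this
    have hgram : ∀ y i (v : W.E y),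
        ∑ j, h.inner y (σ i y) (σ j y) * h.inner y (σ j y) v = h.inner y (σ i y) v := by
      intro y i v
      conv_rhs => rw [hpar y v, h.inner_sum_smul_right]
      simp only [mul_comm]
    have hpc : Continuous fun y => Matrix.of fun i j => h.inner y (σ i y) (σ j y) :=
      continuous_pi fun i => continuous_pi fun j => continuousOn_univ.1
        (h.continuousOn_inner (hσ i).continuousOn (hσ j).continuousOn)
    refine ⟨n, ⟨_, hpc⟩, fun y => ⟨?_, ?_⟩, fun e i =>
      ⟨⟨fun x => h.inner (ι x) (σ i (ι x)) (Φ e x), hcoef _ (hmem e).1 i⟩, (hmem e).2 i⟩,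
      fun e f hef => hinj ?_, fun e f => ?_, fun a e i => ?_, ?_⟩
    · ext i k
      exact hgram y i (σ k y)
    · ext i j
      exact h.conj_symm y _ _
    · funext x
      rw [hpar (ι x) (Φ e x), hpar (ι x) (Φ f x)]
      refine Finset.sum_congr rfl fun i _ => ?_
      congr 1
      exact congrArg (fun w : Fin n → C₀(X, ℂ) => w i x) hef
    · funext i
      ext x
      simp [hadd, h.add_right]
    · ext x
      simp [hsmul, h.smul_right]
    · refine Set.Subset.antisymm ?_ ?_
      · rintro _ ⟨e, rfl⟩ i x
        exact hgram (ι x) i (Φ e x)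
      · intro v hv
        let s : ∀ x, W.E (ι x) := fun x => ∑ j, v j x • σ j (ι x)
        have hs : ∀ x i, h.inner (ι x) (σ i (ι x)) (s x) = v i x := fun x i => by
          rw [h.inner_sum_smul_right, ← hv i x]
          exact Finset.sum_congr rfl fun j _ => mul_comm _ _
        have hsr : s ∈ Set.range Φ := by
          rw [hrange]
          refine ⟨hcont X ι s hemb.continuous fun i => ?_, fun i => ?_⟩
          · simp only [hs]
            exact (v i).continuous
          · simp only [hs]
            exact (v i).zero_at_infty'
        obtain ⟨e, he⟩ := hsr
        refine ⟨e, funext fun i => ?_⟩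
        ext x
        exact (congrArg (h.inner (ι x) (σ i (ι x))) (congrFun he x)).trans (hs x i)
end

section
/- Define p : ℂ → M₂(ℂ) by p(z) = (1+|z|²)^{-1} · [[1, conj(z)], [z, |z|²]] and w : ℂ → M₂(ℂ) by w(z) = [[(1+|z|²)^{-1/2}, 0], [z·(1+|z|²)^{-1/2}, 0]]. Then for every z ∈ ℂ: (i) p(z) is a self-adjoint idempotent (p(z)² = p(z) = p(z)*); (ii) w(z)·w(z)* = p(z); (iii) w(z)*·w(z) = [[1,0],[0,0]]. Moreover, p(z) converges to [[0,0],[0,1]] as z → ∞ along the cocompact filter on ℂ; hence p extends to a continuous M₂(ℂ)-valued function on the one-point compactification ℂ ∪ {∞}. -/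
open Filter Topology

lemma one_add_normSq_ne_zero (z : ℂ) : (1 : ℂ) + (Complex.normSq z : ℂ) ≠ 0 := by
  have h := Complex.normSq_nonneg z
  exact_mod_cast (by positivity : (1 + Complex.normSq z : ℝ) ≠ 0)

lemma inv_sqrt_one_add_normSq_mul_self (z : ℂ) :
    ((Real.sqrt (1 + Complex.normSq z) : ℂ))⁻¹ * ((Real.sqrt (1 + Complex.normSq z) : ℂ))⁻¹ =
      ((1 : ℂ) + (Complex.normSq z : ℂ))⁻¹ := by
  have h := Complex.normSq_nonneg z
  rw [← mul_inv, ← Complex.ofReal_mul, Real.mul_self_sqrt (by positivity)]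
  push_cast
  rfl

lemma tendsto_inv_one_add_normSq_cocompact :
    Tendsto (fun z : ℂ => ((1 : ℂ) + (Complex.normSq z : ℂ))⁻¹) (cocompact ℂ) (𝓝 0) := by
  have h : Tendsto (fun z : ℂ => (1 + Complex.normSq z)⁻¹) (cocompact ℂ) (𝓝 0) :=
    (tendsto_atTop_add_const_left _ 1 Complex.tendsto_normSq_cocompact_atTop).inv_tendsto_atTop
  simpa [Function.comp_def] using (Complex.continuous_ofReal.tendsto 0).comp h

lemma tendsto_inv_one_add_normSq_mul_self_cocompact :
    Tendsto (fun z : ℂ => ((1 : ℂ) + (Complex.normSq z : ℂ))⁻¹ * z) (cocompact ℂ) (𝓝 0) := by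
  refine squeeze_zero_norm (fun z => ?_)
    (tendsto_norm_cocompact_atTop (E := ℂ)).inv_tendsto_atTop
  have h := Complex.normSq_nonneg z
  have hn : ‖(1 : ℂ) + (Complex.normSq z : ℂ)‖ = 1 + ‖z‖ ^ 2 := by
    rw [← Complex.normSq_eq_norm_sq, ← Complex.ofReal_one, ← Complex.ofReal_add,
      Complex.norm_real, Real.norm_of_nonneg (by positivity)]
  rw [norm_mul, norm_inv, hn, Pi.inv_apply]
  rcases (norm_nonneg z).eq_or_lt with h0 | h0
  · simp [← h0]
  · rw [inv_mul_le_iff₀ (by positivity), le_mul_inv_iff₀ h0]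
    nlinarith

lemma tendsto_inv_one_add_normSq_mul_normSq_cocompact :
    Tendsto (fun z : ℂ => ((1 : ℂ) + (Complex.normSq z : ℂ))⁻¹ * (Complex.normSq z : ℂ))
      (cocompact ℂ) (𝓝 1) := by
  have h := tendsto_inv_one_add_normSq_cocompact.const_sub 1
  rw [sub_zero] at h
  refine h.congr fun z => ?_
  have hz := one_add_normSq_ne_zero z
  field_simp
  ring

/-- The Hopf-bundle projection `p(z) = (1+|z|²)⁻¹ [[1, z̄],[z, |z|²]]`
is a self-adjoint idempotent, `w(z)·w(z)* = p(z)`, `w(z)*·w(z) = [[1,0],[0,0]]`, and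
`p` tends to `[[0,0],[0,1]]` along the cocompact filter, hence extends continuously to
the one-point compactification `ℂ ∪ {∞}`. -/
theorem hopf_projection_properties
    (p w : ℂ → Matrix (Fin 2) (Fin 2) ℂ)
    (hp : ∀ z : ℂ, p z = ((1 : ℂ) + (Complex.normSq z : ℂ))⁻¹ •
      !![1, (starRingEnd ℂ) z; z, (Complex.normSq z : ℂ)])
    (hw : ∀ z : ℂ, w z = !![((Real.sqrt (1 + Complex.normSq z) : ℂ))⁻¹, 0;
      z * ((Real.sqrt (1 + Complex.normSq z) : ℂ))⁻¹, 0]) :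
    (∀ z : ℂ, p z * p z = p z ∧ star (p z) = p z) ∧
    (∀ z : ℂ, w z * star (w z) = p z) ∧
    (∀ z : ℂ, star (w z) * w z = !![1, 0; 0, 0]) ∧
    Tendsto p (cocompact ℂ) (𝓝 !![0, 0; 0, 1]) ∧
    ∃ P : C(OnePoint ℂ, Matrix (Fin 2) (Fin 2) ℂ), ∀ z : ℂ, P (z : OnePoint ℂ) = p z := by
  have hstar (z : ℂ) : star (p z) = p z := by
    rw [hp]
    ext i j
    fin_cases i <;> fin_cases j <;> simp [Matrix.star_apply]
  have htend : Tendsto p (cocompact ℂ) (𝓝 !![0, 0; 0, 1]) := by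
    refine tendsto_pi_nhds.2 fun i => tendsto_pi_nhds.2 fun j => ?_
    simp only [hp]
    fin_cases i <;> fin_cases j
    · simpa using tendsto_inv_one_add_normSq_cocompact
    · simpa [Function.comp_def] using (Complex.continuous_conj.tendsto 0).comp
        tendsto_inv_one_add_normSq_mul_self_cocompact
    · simpa using tendsto_inv_one_add_normSq_mul_self_cocompact
    · simpa using tendsto_inv_one_add_normSq_mul_normSq_cocompact
  have hcont : Continuous p := by
    rw [funext hp]
    have hnormSq : Continuous fun z : ℂ => (Complex.normSq z : ℂ) :=
      Complex.continuous_ofReal.comp Complex.continuous_normSq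
    refine ((continuous_const.add hnormSq).inv₀ one_add_normSq_ne_zero).smul ?_
    refine continuous_matrix fun i j => ?_
    fin_cases i <;> fin_cases j
    · exact continuous_const
    · exact Complex.continuous_conj
    · exact continuous_id
    · exact hnormSq
  refine ⟨fun z => ⟨?_, hstar z⟩, fun z => ?_, fun z => ?_, htend, ?_⟩
  · have hz := one_add_normSq_ne_zero z
    have hc := Complex.mul_conj z
    rw [hp]
    ext i j
    fin_cases i <;> fin_cases j <;> simp [Matrix.mul_apply] <;> field_simp <;>
      linear_combination hc
  · have hs := inv_sqrt_one_add_normSq_mul_self z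
    have hc := Complex.mul_conj z
    rw [hp, hw, ← hs]
    ext i j
    fin_cases i <;> fin_cases j <;> simp [Matrix.mul_apply, Matrix.star_apply] <;>
      first
      | ring1
      | linear_combination ((Real.sqrt (1 + Complex.normSq z) : ℂ))⁻¹ ^ 2 * hc
  · have hs := inv_sqrt_one_add_normSq_mul_self z
    have hz := one_add_normSq_ne_zero z
    have hc := Complex.mul_conj z
    rw [hw]
    ext i j
    fin_cases i <;> fin_cases j <;> simp [Matrix.mul_apply, Matrix.star_apply]
    linear_combination (1 + z * (starRingEnd ℂ) z) * hs +
      ((1 : ℂ) + (Complex.normSq z : ℂ))⁻¹ * hc + inv_mul_cancel₀ hz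
  · refine ⟨⟨fun x => x.elim !![0, 0; 0, 1] p, ?_⟩, fun z => rfl⟩
    rw [OnePoint.continuous_iff, coclosedCompact_eq_cocompact]
    exact ⟨htend, hcont⟩
end

section
/- (Serre–Swan) Let X be a compact Hausdorff space. A C(X,ℂ)-module M is finitely generated and projective if and only if there is a locally trivial complex vector bundle V of finite rank over X such that M is isomorphic as a C(X,ℂ)-module to the module Γ(X,V) of all continuous sections of V. -/
open Filter Topology

section IdempotentFamily

variable {X : Type} [TopologicalSpace X] {F : Type} [NormedAddCommGroup F] [NormedSpace ℂ F]

/-- The image at `x` of a family of endomorphisms, carrying no topology. -/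
def ImageFibre (P : X → F →L[ℂ] F) (x : X) : Type := (P x).toLinearMap.range

namespace ImageFibre

noncomputable instance (P : X → F →L[ℂ] F) (x : X) : AddCommGroup (ImageFibre P x) :=
  inferInstanceAs (AddCommGroup (P x).toLinearMap.range)

noncomputable instance (P : X → F →L[ℂ] F) (x : X) : Module ℂ (ImageFibre P x) :=
  inferInstanceAs (Module ℂ (P x).toLinearMap.range)

/-- The inclusion of the total space of images into the trivial bundle. -/
def incl (P : X → F →L[ℂ] F) (q : Σ x, ImageFibre P x) : X × F := (q.1, q.2.1)

/-- The subspace topology on the total space of images. -/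
instance (P : X → F →L[ℂ] F) : TopologicalSpace (Σ x, ImageFibre P x) :=
  TopologicalSpace.induced (incl P) inferInstance

theorem continuous_incl (P : X → F →L[ℂ] F) : Continuous (incl P) :=
  continuous_induced_dom

end ImageFibre

variable {P : X → F →L[ℂ] F}

/-- The endomorphism intertwining the idempotents `p` and `q`. -/
def intertwiner {A : Type*} [Ring A] (p q : A) : A := p * q + (1 - p) * (1 - q)

theorem mul_intertwiner {A : Type*} [Ring A] {p q : A} (hp : IsIdempotentElem p)
    (hq : IsIdempotentElem q) : p * intertwiner p q = intertwiner p q * q := by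
  have hp' : p * p = p := hp
  have hq' : q * q = q := hq
  have h1 : p * (1 - p) = 0 := by rw [mul_sub, hp', mul_one, sub_self]
  have h2 : (1 - q) * q = 0 := by rw [sub_mul, hq', one_mul, sub_self]
  rw [intertwiner, mul_add, add_mul, ← mul_assoc, ← mul_assoc, h1, hp', mul_assoc, mul_assoc,
    h2, hq']
  simp

theorem intertwiner_self {A : Type*} [Ring A] {p : A} (hp : IsIdempotentElem p) :
    intertwiner p p = 1 := by
  have hp' : p * p = p := hp
  simp [intertwiner, mul_sub, sub_mul, hp']

theorem mul_inverse_intertwiner {A : Type*} [Ring A] {p q : A} (hp : IsIdempotentElem p)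
    (hq : IsIdempotentElem q) (hu : IsUnit (intertwiner p q)) :
    q * Ring.inverse (intertwiner p q) = Ring.inverse (intertwiner p q) * p := by
  calc q * Ring.inverse (intertwiner p q)
      = Ring.inverse (intertwiner p q) * (intertwiner p q * q) *
          Ring.inverse (intertwiner p q) := by
        rw [← mul_assoc, Ring.inverse_mul_cancel _ hu, one_mul]
    _ = Ring.inverse (intertwiner p q) * p := by
        rw [← mul_intertwiner hp hq, mul_assoc, mul_assoc, Ring.mul_inverse_cancel _ hu, mul_one]

theorem isIdempotentElem_toLinearMap {p : F →L[ℂ] F} (hp : IsIdempotentElem p) :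
    IsIdempotentElem p.toLinearMap :=
  LinearMap.ext fun v => DFunLike.congr_fun (show p * p = p from hp) v

theorem mem_range_of_idempotent {p : F →L[ℂ] F} (hp : IsIdempotentElem p) {v : F} :
    v ∈ p.toLinearMap.range ↔ p v = v :=
  LinearMap.IsIdempotentElem.mem_range_iff (isIdempotentElem_toLinearMap hp)

/-- Two idempotents whose intertwiner is invertible have isomorphic images. -/
noncomputable def rangeEquivOfIntertwiner {p q : F →L[ℂ] F} (hp : IsIdempotentElem p)
    (hq : IsIdempotentElem q) (hu : IsUnit (intertwiner p q)) :
    p.toLinearMap.range ≃ₗ[ℂ] q.toLinearMap.range where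
  toFun v := ⟨Ring.inverse (intertwiner p q) v.1, by
    rw [mem_range_of_idempotent hq]
    have h := DFunLike.congr_fun (mul_inverse_intertwiner hp hq hu) v.1
    have hv := (mem_range_of_idempotent hp).1 v.2
    simpa [hv] using h⟩
  invFun v := ⟨intertwiner p q v.1, by
    rw [mem_range_of_idempotent hp]
    have h := DFunLike.congr_fun (mul_intertwiner hp hq) v.1
    have hv := (mem_range_of_idempotent hq).1 v.2
    simpa [hv] using h⟩
  map_add' v w := Subtype.ext (map_add _ _ _)
  map_smul' c v := Subtype.ext (map_smul _ _ _)
  left_inv v := Subtype.ext <| by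
    simpa using DFunLike.congr_fun (Ring.mul_inverse_cancel _ hu) v.1
  right_inv v := Subtype.ext <| by
    simpa using DFunLike.congr_fun (Ring.inverse_mul_cancel _ hu) v.1

/-- The vector bundle of images of a continuous family of idempotents. -/
noncomputable def imageBundle [FiniteDimensional ℂ F] (hc : Continuous P)
    (hP : ∀ x, IsIdempotentElem (P x)) : CplxVectorBundle X where
  E := ImageFibre P
  locTriv x₀ := by
    have : CompleteSpace F := FiniteDimensional.complete ℂ F
    set T : X → F →L[ℂ] F := fun x => intertwiner (P x) (P x₀) with hT
    have hTc : Continuous T := by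
      simp only [hT, intertwiner]
      fun_prop
    let b : (P x₀).toLinearMap.range ≃ₗ[ℂ] (Fin (Module.finrank ℂ (P x₀).toLinearMap.range) → ℂ) :=
      (Module.finBasis ℂ (P x₀).toLinearMap.range).equivFun
    refine ⟨Module.finrank ℂ (P x₀).toLinearMap.range, {x | IsUnit (T x)},
      Units.isOpen.preimage hTc, ?_,
      fun x hx => (rangeEquivOfIntertwiner (hP x) (hP x₀) hx).trans b, ?_⟩
    · simp [hT, intertwiner_self (hP x₀)]
    · have hbc : Continuous b := b.toLinearMap.continuous_of_finiteDimensional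
      have hbs : Continuous b.symm := b.symm.toLinearMap.continuous_of_finiteDimensional
      have hincl : Continuous fun p : {q : Σ x, ImageFibre P x // q.1 ∈ {x | IsUnit (T x)}} =>
          ImageFibre.incl P p.1 := (ImageFibre.continuous_incl P).comp continuous_subtype_val
      refine isHomeomorph_iff_exists_inverse.2 ⟨?_, fun p => ⟨⟨p.1.1,
        (rangeEquivOfIntertwiner (hP p.1.1) (hP x₀) p.1.2).symm (b.symm p.2)⟩, p.1.2⟩, ?_, ?_, ?_⟩
      · refine (Continuous.subtype_mk hincl.fst _).prodMk (hbc.comp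
          (Continuous.subtype_mk
            (f := fun p : {q : Σ x, ImageFibre P x // q.1 ∈ {x | IsUnit (T x)}} =>
              Ring.inverse (T p.1.1) p.1.2.1) ?_ _))
        refine Continuous.clm_apply ?_ hincl.snd
        refine continuous_iff_continuousAt.2 fun p => ?_
        obtain ⟨u, hu⟩ := p.2
        refine ContinuousAt.comp (g := Ring.inverse) (f := fun p : {q : Σ x, ImageFibre P x //
          q.1 ∈ {x | IsUnit (T x)}} => T p.1.1) ?_ (hTc.comp hincl.fst).continuousAt
        exact hu ▸ NormedRing.inverse_continuousAt u
      · rintro ⟨⟨x, v⟩, hx⟩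
        refine Subtype.ext (Sigma.ext rfl (heq_of_eq ?_))
        exact ((rangeEquivOfIntertwiner (hP x) (hP x₀) hx).trans b).symm_apply_apply v
      · rintro ⟨⟨x, hx⟩, w⟩
        refine Prod.ext rfl ?_
        exact ((rangeEquivOfIntertwiner (hP x) (hP x₀) hx).trans b).apply_symm_apply w
      · refine Continuous.subtype_mk (continuous_induced_rng.2 ?_) _
        refine (continuous_subtype_val.comp continuous_fst).prodMk ?_
        exact (hTc.comp (continuous_subtype_val.comp continuous_fst)).clm_apply
          (continuous_subtype_val.comp (hbs.comp continuous_snd))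

theorem isContinuousSection_imageBundle [FiniteDimensional ℂ F] (hc : Continuous P)
    (hP : ∀ x, IsIdempotentElem (P x)) (s : ∀ x, ImageFibre P x) :
    (imageBundle hc hP).IsContinuousSection s ↔ Continuous fun x => (s x).1 := by
  refine continuous_induced_rng.trans ⟨fun h => h.snd, fun h => ?_⟩
  exact continuous_id.prodMk h

end IdempotentFamily

section Evaluation

variable {X : Type} [TopologicalSpace X] {n : ℕ}

/-- The fibre at `x` of an endomorphism of the free module `C(X, ℂ)^n`. -/
noncomputable def fibreMap (p : (Fin n → C(X, ℂ)) →ₗ[C(X, ℂ)] (Fin n → C(X, ℂ))) (x : X) :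
    (Fin n → ℂ) →L[ℂ] (Fin n → ℂ) :=
  LinearMap.toContinuousLinearMap
    { toFun := fun v i => p (fun j => ContinuousMap.const X (v j)) i x
      map_add' := fun v w => by
        have h : (fun j => ContinuousMap.const X ((v + w) j)) =
          (fun j => ContinuousMap.const X (v j)) + fun j => ContinuousMap.const X (w j) := rfl
        simp only [h, map_add]
        rfl
      map_smul' := fun c v => by
        have h : (fun j => ContinuousMap.const X ((c • v) j)) =
          ContinuousMap.const X c • fun j => ContinuousMap.const X (v j) := rfl
        simp only [h, map_smul]
        rfl }

theorem fibreMap_apply (p : (Fin n → C(X, ℂ)) →ₗ[C(X, ℂ)] (Fin n → C(X, ℂ))) (x : X)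
    (f : Fin n → C(X, ℂ)) : fibreMap p x (fun i => f i x) = fun i => p f i x := by
  ext i
  change p (fun j => ContinuousMap.const X (f j x)) i x = p f i x
  rw [LinearMap.pi_apply_eq_sum_univ p, LinearMap.pi_apply_eq_sum_univ p f]
  simp

theorem continuous_fibreMap (p : (Fin n → C(X, ℂ)) →ₗ[C(X, ℂ)] (Fin n → C(X, ℂ))) :
    Continuous (fibreMap p) :=
  continuous_clm_apply.2 fun v => continuous_pi fun i =>
    (p (fun j => ContinuousMap.const X (v j)) i).continuous

theorem isIdempotentElem_fibreMap {p : (Fin n → C(X, ℂ)) →ₗ[C(X, ℂ)] (Fin n → C(X, ℂ))}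
    (hp : IsIdempotentElem p) (x : X) : IsIdempotentElem (fibreMap p x) := by
  ext1 v
  change fibreMap p x (fun i => p (fun j => ContinuousMap.const X (v j)) i x) = _
  rw [fibreMap_apply, ← Module.End.mul_apply, hp.eq]
  rfl

end Evaluation

theorem exists_bundle_of_isCompl {X : Type} [TopologicalSpace X] {M : Type} [AddCommGroup M]
    [Module C(X, ℂ) M] {n : ℕ} {N N' : Submodule C(X, ℂ) (Fin n → C(X, ℂ))} (h : IsCompl N N')
    (e : M ≃ₗ[C(X, ℂ)] N) :
    ∃ (V : CplxVectorBundle X) (Φ : M → (∀ x, V.E x)),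
        Function.Injective Φ ∧
        (∀ m m', Φ (m + m') = Φ m + Φ m') ∧
        (∀ (a : C(X, ℂ)) (m : M) (x : X), Φ (a • m) x = a x • Φ m x) ∧
        Set.range Φ = {s | V.IsContinuousSection s} := by
  let p := N.projection N' h
  have hp : IsIdempotentElem p := Submodule.isIdempotentElem_projection h
  have hP := isIdempotentElem_fibreMap hp
  have hN (f : Fin n → C(X, ℂ)) : f ∈ N ↔ p f = f := (Submodule.projection_eq_self_iff h f).symm
  let Φ : M → ∀ x, ImageFibre (fibreMap p) x := fun m x =>
    ⟨fun i => (e m : Fin n → C(X, ℂ)) i x, (mem_range_of_idempotent (hP x)).2 <| by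
      rw [fibreMap_apply, (hN _).1 (e m).2]⟩
  refine ⟨imageBundle (continuous_fibreMap p) hP, Φ, fun m m' hm => ?_, fun m m' => ?_,
    fun a m x => ?_, ?_⟩
  · refine e.injective (Subtype.ext (funext fun i => ContinuousMap.ext fun x => ?_))
    exact congr_fun (congrArg Subtype.val (congr_fun hm x)) i
  · refine funext fun x => Subtype.ext (funext fun i => ?_)
    change (e (m + m') : Fin n → C(X, ℂ)) i x = _
    rw [map_add]
    rfl
  · refine Subtype.ext (funext fun i => ?_)
    change (e (a • m) : Fin n → C(X, ℂ)) i x = _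
    rw [map_smul]
    rfl
  · ext s
    refine Iff.trans ?_ (isContinuousSection_imageBundle (continuous_fibreMap p) hP s).symm
    constructor
    · rintro ⟨m, rfl⟩
      exact continuous_pi fun i => ((e m : Fin n → C(X, ℂ)) i).continuous
    · intro hs
      let f : Fin n → C(X, ℂ) := fun i => ⟨fun x => (s x).1 i, (continuous_apply i).comp hs⟩
      have hf : f ∈ N := (hN f).2 <| funext fun i => ContinuousMap.ext fun x => by
        have h1 := congr_fun (fibreMap_apply p x f) i
        have h2 := (mem_range_of_idempotent (hP x)).1 (s x).2
        exact h1.symm.trans (congr_fun h2 i)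
      refine ⟨e.symm ⟨f, hf⟩, funext fun x => Subtype.ext (funext fun i => ?_)⟩
      change (e (e.symm ⟨f, hf⟩) : Fin n → C(X, ℂ)) i x = _
      rw [e.apply_symm_apply]
      rfl

namespace CplxVectorBundle

variable {X : Type} [TopologicalSpace X] (V : CplxVectorBundle X)

/-- A local trivialisation of `V` over an open set. -/
structure LocalTriv where
  rank : ℕ
  base : Set X
  isOpen_base : IsOpen base
  equiv : ∀ x, x ∈ base → (V.E x ≃ₗ[ℂ] (Fin rank → ℂ))
  isHomeomorph : IsHomeomorph (fun p : {q : Σ x, V.E x // q.1 ∈ base} =>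
    ((⟨p.1.1, p.2⟩, equiv p.1.1 p.2 p.1.2) : base × (Fin rank → ℂ)))

theorem exists_localTriv (x₀ : X) : ∃ t : V.LocalTriv, x₀ ∈ t.base := by
  obtain ⟨n, U, hU, hx, φ, hφ⟩ := V.locTriv x₀
  exact ⟨⟨n, U, hU, φ, hφ⟩, hx⟩

variable {V}

namespace LocalTriv

variable (t : V.LocalTriv)

open Classical in
/-- The fibre coordinates of `t`, extended by zero outside its base set. -/
noncomputable def coord (x : X) : V.E x →ₗ[ℂ] (Fin t.rank → ℂ) :=
  if h : x ∈ t.base then (t.equiv x h).toLinearMap else 0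

open Classical in
/-- The inverse of the fibre coordinates of `t`, extended by zero outside its base set. -/
noncomputable def frame (x : X) : (Fin t.rank → ℂ) →ₗ[ℂ] V.E x :=
  if h : x ∈ t.base then (t.equiv x h).symm.toLinearMap else 0

theorem frame_coord {x : X} (h : x ∈ t.base) (v : V.E x) : t.frame x (t.coord x v) = v := by
  simp [frame, coord, h]

theorem continuous_coord {s : ∀ x, V.E x} (hs : V.IsContinuousSection s) :
    ContinuousOn (fun x => t.coord x (s x)) t.base := by
  rw [continuousOn_iff_continuous_domRestrict]
  have h : Continuous fun x : t.base => (⟨⟨x.1, s x.1⟩, x.2⟩ : {q : Σ x, V.E x // q.1 ∈ t.base}) :=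
    Continuous.subtype_mk (Continuous.comp hs continuous_subtype_val) _
  refine (continuous_snd.comp (t.isHomeomorph.continuous.comp h)).congr fun x => ?_
  simp [coord, x.2]

theorem continuousAt_frame {w : X → Fin t.rank → ℂ} (hw : Continuous w) {x : X}
    (hx : x ∈ t.base) :
    ContinuousAt (fun y => (⟨y, t.frame y (w y)⟩ : Σ x, V.E x)) x := by
  refine ContinuousOn.continuousAt ?_ (t.isOpen_base.mem_nhds hx)
  rw [continuousOn_iff_continuous_domRestrict]
  let e := t.isHomeomorph.homeomorph
  have h : Continuous fun y : t.base => (e.symm (y, w y.1)).1 :=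
    continuous_subtype_val.comp
      (e.symm.continuous.comp (continuous_id.prodMk (hw.comp continuous_subtype_val)))
  refine h.congr fun y => ?_
  have h' : e.symm (y, w y.1) = ⟨⟨y.1, t.frame y.1 (w y.1)⟩, y.2⟩ := by
    rw [Homeomorph.symm_apply_eq]
    refine Prod.ext rfl ?_
    change w y.1 = t.equiv y.1 y.2 (t.frame y.1 (w y.1))
    simp [frame, y.2]
  rw [h']
  rfl

/-- A coordinate section cut off inside the base set is a global continuous section. -/
theorem isContinuousSection_cutoff {τ : C(X, ℂ)} (hτ : tsupport τ ⊆ t.base)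
    (v : Fin t.rank → ℂ) : V.IsContinuousSection fun x => τ x • t.frame x v := by
  refine continuous_iff_continuousAt.2 fun x => ?_
  by_cases hx : x ∈ t.base
  · have h := t.continuousAt_frame (w := fun y => τ y • v) (by fun_prop) hx
    simpa only [map_smul] using h
  · obtain ⟨t', ht'⟩ := V.exists_localTriv x
    refine (t'.continuousAt_frame (w := fun _ => 0) continuous_const ht').congr ?_
    filter_upwards [notMem_tsupport_iff_eventuallyEq.1 fun h => hx (hτ h)] with y hy
    simp [hy]

/-- The cut-off local coordinates of a continuous section are globally continuous. -/
theorem continuous_mul_coord {τ : C(X, ℂ)}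
    (hτ : tsupport τ ⊆ t.base) {s : ∀ x, V.E x} (hs : V.IsContinuousSection s)
    (k : Fin t.rank) : Continuous fun x => τ x * t.coord x (s x) k := by
  refine continuous_iff_continuousAt.2 fun x => ?_
  by_cases hx : x ∈ t.base
  · have h := (t.continuous_coord hs).continuousAt (t.isOpen_base.mem_nhds hx)
    exact τ.continuous.continuousAt.mul ((continuous_apply k).continuousAt.comp h)
  · refine (continuousAt_const (y := (0 : ℂ))).congr ?_
    filter_upwards [notMem_tsupport_iff_eventuallyEq.1 fun h => hx (hτ h)] with y hy
    simp [hy]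

end LocalTriv

/-- Finitely many trivialisations with cutoff functions whose squares sum to one. -/
theorem exists_finite_cutoffs [CompactSpace X] [T2Space X] (V : CplxVectorBundle X) :
    ∃ (ι : Finset X) (t : ι → V.LocalTriv) (τ : ι → C(X, ℂ)),
      (∀ i, tsupport (τ i) ⊆ (t i).base) ∧ ∀ x, ∑ i, τ i x * τ i x = 1 := by
  choose t ht using V.exists_localTriv
  obtain ⟨ι, hι⟩ := CompactSpace.elim_nhds_subcover (fun x => (t x).base)
    fun x => (t x).isOpen_base.mem_nhds (ht x)
  obtain ⟨ρ, hρ⟩ := PartitionOfUnity.exists_isSubordinate isClosed_univ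
    (fun i : ι => (t i).base) (fun i => (t i).isOpen_base) fun x _ => by
      have hx : x ∈ ⋃ y ∈ ι, (t y).base := hι ▸ Set.mem_univ x
      simpa using hx
  refine ⟨ι, fun i => t i, fun i => ⟨fun x => (Real.sqrt (ρ i x) : ℂ), by fun_prop⟩,
    fun i => ?_, fun x => ?_⟩
  · exact (tsupport_comp_subset (g := fun r : ℝ => (Real.sqrt r : ℂ)) (by simp) (ρ i)).trans
      (hρ i)
  · have h := ρ.sum_eq_one (Set.mem_univ x)
    rw [finsum_eq_sum_of_fintype] at h
    simp only [ContinuousMap.coe_mk, ← Complex.ofReal_mul, Real.mul_self_sqrt (ρ.nonneg _ x)]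
    exact_mod_cast h

end CplxVectorBundle

theorem exists_isCompl_of_bundle {X : Type} [TopologicalSpace X] [CompactSpace X] [T2Space X]
    {M : Type} [AddCommGroup M] [Module C(X, ℂ) M] (V : CplxVectorBundle X)
    (Φ : M → (∀ x, V.E x)) (hinj : Function.Injective Φ)
    (hadd : ∀ m m', Φ (m + m') = Φ m + Φ m')
    (hsmul : ∀ (a : C(X, ℂ)) (m : M) (x : X), Φ (a • m) x = a x • Φ m x)
    (hrange : Set.range Φ = {s | V.IsContinuousSection s}) :
    ∃ (n : ℕ) (N N' : Submodule C(X, ℂ) (Fin n → C(X, ℂ))),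
        IsCompl N N' ∧ Nonempty (M ≃ₗ[C(X, ℂ)] N) := by
  obtain ⟨ι, t, τ, hτ, hsum⟩ := V.exists_finite_cutoffs
  have hΦ (m : M) : V.IsContinuousSection (Φ m) := hrange.subset ⟨m, rfl⟩
  have hgen (q : Σ i, Fin (t i).rank) : ∃ m : M, Φ m =
      fun x => τ q.1 x • (t q.1).frame x (Pi.single q.2 1) :=
    hrange.superset ((t q.1).isContinuousSection_cutoff (hτ q.1) _)
  choose g hg using hgen
  let A : M →ₗ[C(X, ℂ)] ((Σ i, Fin (t i).rank) → C(X, ℂ)) :=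
    { toFun := fun m q => ⟨_, (t q.1).continuous_mul_coord (hτ q.1) (hΦ m) q.2⟩
      map_add' := fun m m' => funext fun q => ContinuousMap.ext fun x => by
        simp [hadd, mul_add]
      map_smul' := fun a m => funext fun q => ContinuousMap.ext fun x => by
        simp [hsmul, mul_left_comm] }
  let B := Fintype.linearCombination C(X, ℂ) g
  have hBA : B ∘ₗ A = LinearMap.id := by
    refine LinearMap.ext fun m => hinj (funext fun x => ?_)
    let ev : M →+ V.E x := AddMonoidHom.mk' (fun m => Φ m x) fun m m' => congr_fun (hadd m m') x
    change ev (∑ q, A m q • g q) = Φ m x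
    calc ev (∑ q, A m q • g q)
        = ∑ q : Σ i, Fin (t i).rank, (τ q.1 x * (t q.1).coord x (Φ m x) q.2) •
            τ q.1 x • (t q.1).frame x (Pi.single q.2 1) := by
          rw [map_sum]
          refine Finset.sum_congr rfl fun q _ => ?_
          exact (hsmul _ _ x).trans (by rw [hg]; rfl)
      _ = ∑ i, (τ i x * τ i x) • Φ m x := by
          rw [Fintype.sum_sigma]
          refine Finset.sum_congr rfl fun i _ => ?_
          by_cases hx : x ∈ (t i).base
          · conv_rhs => rw [← (t i).frame_coord hx (Φ m x),
              LinearMap.pi_apply_eq_sum_univ ((t i).frame x), Finset.smul_sum]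
            refine Finset.sum_congr rfl fun k _ => ?_
            rw [smul_smul, smul_smul]
            congr 1
            · ring
            · congr 1
              ext j
              simp [Pi.single_apply, eq_comm]
          · have h0 : τ i x = 0 := image_eq_zero_of_notMem_tsupport fun h => hx (hτ i h)
            simp [h0]
      _ = Φ m x := by rw [← Finset.sum_smul, hsum, one_smul]
  have := Module.Projective.of_split A B hBA
  have := Module.Finite.of_surjective B fun m => ⟨A m, DFunLike.congr_fun hBA m⟩
  obtain ⟨n, f, j, -, hj, hfj⟩ := Module.Finite.exists_comp_eq_id_of_projective C(X, ℂ) M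
  have hid : IsIdempotentElem (j ∘ₗ f) := LinearMap.ext fun v =>
    congrArg j (DFunLike.congr_fun hfj (f v))
  have hran : (j ∘ₗ f).range = j.range := by
    refine le_antisymm (LinearMap.range_comp_le_range f j) ?_
    rintro _ ⟨m, rfl⟩
    exact ⟨j m, congrArg j (DFunLike.congr_fun hfj m)⟩
  exact ⟨n, j.range, _, hran ▸ LinearMap.IsIdempotentElem.isCompl hid,
    ⟨LinearEquiv.ofInjective j hj⟩⟩

/-- Serre–Swan. For a compact Hausdorff space `X`, a `C(X,ℂ)`-module
`M` is finitely generated and projective (i.e., a direct summand of `C(X,ℂ)^n` for some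
`n`) iff `M` is isomorphic as a `C(X,ℂ)`-module to the module `Γ(X,V)` of all
continuous sections of some locally trivial finite-rank complex vector bundle `V` over
`X`. -/
theorem serre_swan (X : Type) [TopologicalSpace X] [CompactSpace X] [T2Space X]
    (M : Type) [AddCommGroup M] [Module C(X, ℂ) M] :
    (∃ (n : ℕ) (N N' : Submodule C(X, ℂ) (Fin n → C(X, ℂ))),
        IsCompl N N' ∧ Nonempty (M ≃ₗ[C(X, ℂ)] N)) ↔
      ∃ (V : CplxVectorBundle X) (Φ : M → (∀ x, V.E x)),
        Function.Injective Φ ∧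
        (∀ m m', Φ (m + m') = Φ m + Φ m') ∧
        (∀ (a : C(X, ℂ)) (m : M) (x : X), Φ (a • m) x = a x • Φ m x) ∧
        Set.range Φ = {s | V.IsContinuousSection s} := by
  exact ⟨fun ⟨_, _, _, h, ⟨e⟩⟩ => exists_bundle_of_isCompl h e,
    fun ⟨V, Φ, hinj, hadd, hsmul, hrange⟩ =>
      exists_isCompl_of_bundle V Φ hinj hadd hsmul hrange⟩
end
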